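/- arXiv:2011.01467 — 5 statements merged into one kernel-verified Lean document; each statement's English description precedes it below -/
import Mathlib

section
/- For all n, k ≥ 8 and 2 ≤ m ≤ nk/2, the coefficients of the Gaussian coefficient are strictly increasing at m: p(k,n,m) − p(k,n,m−1) ≥ 1 (strict unimodality of Gaussian coefficients, Pak–Panova). -/
/-- Number of partitions of `m` with at most `k` parts, each part at most `n`
(partitions contained in a `k × n` rectangle). -/
def p (k n m : ℕ) : ℕ :=
  Fintype.card {π : Nat.Partition m // π.parts.card ≤ k ∧ ∀ j ∈ π.parts, j ≤ n}

namespace PPU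
open MvPolynomial

/-- bi-weight of the variable `x_i`. -/
def wt (n : ℕ) (i : Fin (n + 1)) : ℤ × ℤ := (1, (i : ℤ))

abbrev Poly (n : ℕ) := MvPolynomial (Fin (n + 1)) ℚ

/-- lowering operator -/
noncomputable def E (n : ℕ) : Derivation ℚ (Poly n) (Poly n) :=
  ∑ i : Fin n, (((i : ℚ) + 1) • (X i.castSucc : Poly n)) • pderiv i.succ

/-- raising operator -/
noncomputable def F (n : ℕ) : Derivation ℚ (Poly n) (Poly n) :=
  ∑ i : Fin n, (((n : ℚ) - i) • (X i.succ : Poly n)) • pderiv i.castSucc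

noncomputable def H (n : ℕ) : Derivation ℚ (Poly n) (Poly n) :=
  ∑ i : Fin (n + 1), (((n : ℚ) - 2 * i) • (X i : Poly n)) • pderiv i

theorem sum_der {n : ℕ} {ι : Type*} (s : Finset ι) (D : ι → Derivation ℚ (Poly n) (Poly n))
    (f : Poly n) : (∑ i ∈ s, D i) f = ∑ i ∈ s, D i f := by
  classical
  induction s using Finset.induction_on with
  | empty => simp
  | insert a s ha ih => rw [Finset.sum_insert ha, Finset.sum_insert ha, Derivation.add_apply, ih]

theorem E_apply (n : ℕ) (f : Poly n) :
    E n f = ∑ i : Fin n, ((i : ℚ) + 1) • (X i.castSucc * pderiv i.succ f) := by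
  simp [E, sum_der]

theorem F_apply (n : ℕ) (f : Poly n) :
    F n f = ∑ i : Fin n, ((n : ℚ) - i) • (X i.succ * pderiv i.castSucc f) := by
  simp [F, sum_der]

theorem H_apply (n : ℕ) (f : Poly n) :
    H n f = ∑ i : Fin (n + 1), ((n : ℚ) - 2 * i) • (X i * pderiv i f) := by
  simp [H, sum_der]

abbrev R (n : ℕ) (k m : ℤ) : Submodule ℚ (Poly n) := weightedHomogeneousSubmodule ℚ (wt n) (k, m)

theorem E_mem {n : ℕ} {k m m' : ℤ} {f : Poly n} (hf : f ∈ R n k m) (h : m' = m - 1) :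
    E n f ∈ R n k m' := by
  subst h
  rw [E_apply]
  refine Submodule.sum_mem _ fun i _ => Submodule.smul_mem _ _ ?_
  have h1 : IsWeightedHomogeneous (wt n) (pderiv i.succ f) (k - 1, m - (i + 1)) :=
    IsWeightedHomogeneous.pderiv (n := (k, m)) hf (by simp [wt])
  have h2 := (isWeightedHomogeneous_X ℚ (wt n) i.castSucc).mul h1
  rw [mem_weightedHomogeneousSubmodule]
  convert! h2 using 1
  simp [wt]; ring

theorem F_mem {n : ℕ} {k m m' : ℤ} {f : Poly n} (hf : f ∈ R n k m) (h : m' = m + 1) :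
    F n f ∈ R n k m' := by
  subst h
  rw [F_apply]
  refine Submodule.sum_mem _ fun i _ => Submodule.smul_mem _ _ ?_
  have h1 : IsWeightedHomogeneous (wt n) (pderiv i.castSucc f) (k - 1, m - i) :=
    IsWeightedHomogeneous.pderiv (n := (k, m)) hf (by simp [wt])
  have h2 := (isWeightedHomogeneous_X ℚ (wt n) i.succ).mul h1
  rw [mem_weightedHomogeneousSubmodule]
  convert! h2 using 1
  simp [wt]; ring

theorem weight_eq (n : ℕ) (d : Fin (n + 1) →₀ ℕ) :
    Finsupp.weight (wt n) d = (∑ i, (d i : ℤ), ∑ i, (d i : ℤ) * (i : ℤ)) := by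
  rw [Finsupp.weight_apply, Finsupp.sum_fintype _ _ (by simp)]
  ext <;> simp [wt, Prod.fst_sum, Prod.snd_sum]

theorem H_eq {n : ℕ} {k m : ℤ} {f : Poly n} (hf : f ∈ R n k m) :
    H n f = ((n : ℚ) * k - 2 * m) • f := by
  rw [mem_weightedHomogeneousSubmodule] at hf
  induction hf using IsWeightedHomogeneous.induction_on with
  | zero => simp
  | add p q hp hq h1 h2 => rw [map_add, h1, h2, smul_add]
  | monomial d r hd =>
    rw [weight_eq, Prod.mk.injEq] at hd
    obtain ⟨h1, h2⟩ := hd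
    rw [H_apply]
    simp_rw [X_mul_pderiv_monomial, ← Nat.cast_smul_eq_nsmul ℚ, smul_smul, ← Finset.sum_smul]
    congr 1
    rw [← h1, ← h2]
    push_cast
    rw [Finset.mul_sum, Finset.mul_sum, ← Finset.sum_sub_distrib]
    exact Finset.sum_congr rfl fun i _ => by ring

theorem E_X_succ {n : ℕ} (i : Fin n) : E n (X i.succ) = ((i : ℚ) + 1) • X i.castSucc := by
  rw [E_apply, Finset.sum_eq_single i]
  · simp
  · intro j _ hj
    rw [pderiv_X_of_ne (by simpa using hj.symm)]; simp
  · simp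
theorem E_X_zero {n : ℕ} : E n (X 0) = 0 := by
  rw [E_apply]
  refine Finset.sum_eq_zero fun j _ => ?_
  rw [pderiv_X_of_ne (Fin.succ_ne_zero j).symm]; simp
theorem F_X_castSucc {n : ℕ} (i : Fin n) : F n (X i.castSucc) = ((n : ℚ) - i) • X i.succ := by
  rw [F_apply, Finset.sum_eq_single i]
  · simp
  · intro j _ hj
    rw [pderiv_X_of_ne (by simpa using hj.symm)]; simp
  · simp
theorem F_X_last {n : ℕ} : F n (X (Fin.last n)) = 0 := by
  rw [F_apply]
  refine Finset.sum_eq_zero fun j _ => ?_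
  rw [pderiv_X_of_ne (Fin.castSucc_lt_last j).ne']; simp
theorem H_X {n : ℕ} (i : Fin (n + 1)) : H n (X i) = ((n : ℚ) - 2 * i) • X i := by
  rw [H_apply, Finset.sum_eq_single i]
  · simp
  · intro j _ hj
    rw [pderiv_X_of_ne hj.symm]; simp
  · simp

theorem EF_X {n : ℕ} (i : Fin (n + 1)) :
    E n (F n (X i)) = (((n : ℚ) - i) * (i + 1)) • X i := by
  induction i using Fin.lastCases with
  | last => simp [F_X_last]
  | cast i => rw [F_X_castSucc, Derivation.map_smul, E_X_succ, smul_smul]; simp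
theorem FE_X {n : ℕ} (i : Fin (n + 1)) :
    F n (E n (X i)) = ((i : ℚ) * (n - i + 1)) • X i := by
  induction i using Fin.cases with
  | zero => simp [E_X_zero]
  | succ i =>
    rw [E_X_succ, Derivation.map_smul, F_X_castSucc, smul_smul]; congr 1; simp only [Fin.val_succ]; push_cast; ring

theorem comm (n : ℕ) (f : Poly n) : E n (F n f) = F n (E n f) + H n f := by
  have : ⁅E n, F n⁆ = H n := by
    apply derivation_ext
    intro i
    rw [Derivation.commutator_apply, EF_X, FE_X, H_X, ← sub_smul]
    congr 1; ring
  rw [← this, Derivation.commutator_apply]; abel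

theorem Epow_mem {n : ℕ} {k m : ℤ} {f : Poly n} (hf : f ∈ R n k m) (r : ℕ) :
    (E n)^[r] f ∈ R n k (m - r) := by
  induction r with
  | zero => simpa using hf
  | succ r ih =>
    rw [Function.iterate_succ_apply']
    exact E_mem ih (by push_cast; ring)

theorem Epow_F {n : ℕ} {k m : ℤ} {f : Poly n} (hf : f ∈ R n k m) (r : ℕ) :
    (E n)^[r + 1] (F n f) = F n ((E n)^[r + 1] f)
      + (((r : ℚ) + 1) * (n * k - 2 * m + r)) • (E n)^[r] f := by
  induction r with
  | zero => simp [comm, H_eq hf]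
  | succ r ih =>
    rw [Function.iterate_succ_apply', ih, map_add, Derivation.map_smul, comm, H_eq (Epow_mem hf (r + 1)),
      ← Function.iterate_succ_apply' (E n) (r + 1), ← Function.iterate_succ_apply' (E n) r,
      add_assoc, ← add_smul]
    congr 2
    push_cast; ring

theorem E_surj_aux {n : ℕ} {k m : ℤ} (h : 0 < n * k - 2 * m) (r : ℕ) :
    ∀ f ∈ R n k m, (E n)^[r] f = 0 → ∃ g ∈ R n k (m + 1), E n g = f := by
  induction r with
  | zero => intro f _ h0; exact ⟨0, Submodule.zero_mem _, by simpa using h0.symm⟩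
  | succ r ih =>
    intro f hf h0
    have key := Epow_F hf r
    set c : ℚ := ((r : ℚ) + 1) * (n * k - 2 * m + r) with hc
    have hcpos : 0 < c := by
      have : (0 : ℚ) < n * k - 2 * m := by exact_mod_cast h
      positivity
    have hF := F_mem hf rfl
    have hEF : E n (F n f) ∈ R n k m := E_mem hF (by ring)
    have hit : ∀ a b : Poly n, (E n)^[r] (a - b) = (E n)^[r] a - (E n)^[r] b := fun a b => by
      exact iterate_map_sub (E n) r a b
    have hits : ∀ (a : ℚ) (b : Poly n), (E n)^[r] (a • b) = a • (E n)^[r] b := fun a b => by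
      have := Function.Commute.iterate_left (f := E n) (g := fun x => a • x)
        (fun x => by simp) r
      exact this b
    obtain ⟨g, hg, hgE⟩ := ih (E n (F n f) - c • f)
      (Submodule.sub_mem _ hEF (Submodule.smul_mem _ _ hf)) (by
        rw [hit, hits, ← Function.iterate_succ_apply, key, h0, map_zero, zero_add, sub_self])
    refine ⟨c⁻¹ • (F n f - g), Submodule.smul_mem _ _ (Submodule.sub_mem _ hF hg), ?_⟩
    rw [Derivation.map_smul, map_sub, hgE, sub_sub_cancel, smul_smul, inv_mul_cancel₀ hcpos.ne', one_smul]

theorem R_neg {n : ℕ} {k m : ℤ} (hm : m < 0) {f : Poly n} (hf : f ∈ R n k m) : f = 0 := by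
  refine IsWeightedHomogeneous.eq_zero_of_no_monomials hf fun d hd => ?_
  rw [weight_eq, Prod.mk.injEq] at hd
  have : 0 ≤ ∑ i : Fin (n + 1), (d i : ℤ) * (i : ℤ) := Finset.sum_nonneg fun i _ => by positivity
  omega

theorem E_surj {n : ℕ} {k m : ℤ} (h : 0 < n * k - 2 * m) {f : Poly n} (hf : f ∈ R n k m) :
    ∃ g ∈ R n k (m + 1), E n g = f :=
  E_surj_aux h (m.toNat + 1) f hf (R_neg (by push_cast; omega) (Epow_mem hf _))

/-- index set of monomials -/
abbrev Idx (n : ℕ) (k m : ℤ) : Set (Fin (n + 1) →₀ ℕ) := {d | Finsupp.weight (wt n) d = (k, m)}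

theorem R_eq (n : ℕ) (k m : ℤ) : R n k m = restrictSupport ℚ (Idx n k m) :=
  weightedHomogeneousSubmodule_eq_finsupp_supported _ _ _

theorem Idx_finite (n : ℕ) (k m : ℤ) : (Idx n k m).Finite := by
  refine Set.Finite.subset (Finset.finite_toSet
    ((Finset.Iic (Finsupp.equivFunOnFinite.symm fun _ : Fin (n+1) => k.toNat)))) ?_
  intro d hd
  simp only [Set.mem_ofPred_eq, weight_eq, Prod.mk.injEq] at hd
  simp only [Finset.coe_Iic, Set.mem_Iic]
  intro i
  have := Finset.single_le_sum (f := fun i => (d i : ℤ)) (fun i _ => by positivity)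
    (Finset.mem_univ i)
  simp at this ⊢
  omega

theorem R_finite (n : ℕ) (k m : ℤ) : Module.Finite ℚ (R n k m) := by
  rw [R_eq]
  have := (Idx_finite n k m).to_subtype
  exact Module.Finite.of_basis (basisRestrictSupport ℚ (Idx n k m))

theorem R_finrank (n : ℕ) (k m : ℤ) : Module.finrank ℚ (R n k m) = (Idx n k m).ncard := by
  rw [R_eq, Module.finrank_eq_nat_card_basis (basisRestrictSupport ℚ (Idx n k m))]
  rfl

noncomputable def Elin (n : ℕ) (k m : ℤ) : R n k (m + 1) →ₗ[ℚ] R n k m :=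
  (E n).toLinearMap.restrict fun _ hf => E_mem hf (by ring)

/-- strict increase iff there is a nonzero highest weight vector -/
theorem strict_iff {n : ℕ} {k m : ℤ} (h : 0 < n * k - 2 * m) :
    (Idx n k m).ncard < (Idx n k (m + 1)).ncard ↔ ∃ f ∈ R n k (m + 1), f ≠ 0 ∧ E n f = 0 := by
  have := R_finite n k m
  have := R_finite n k (m + 1)
  rw [← R_finrank, ← R_finrank]
  have hrn := LinearMap.finrank_range_add_finrank_ker (Elin n k m)
  have hs : LinearMap.range (Elin n k m) = ⊤ := by
    rw [LinearMap.range_eq_top]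
    rintro ⟨f, hf⟩
    obtain ⟨g, hg, hgf⟩ := E_surj h hf
    exact ⟨⟨g, hg⟩, Subtype.ext hgf⟩
  rw [hs, finrank_top] at hrn
  have : Module.finrank ℚ (R n k m) < Module.finrank ℚ (R n k (m + 1)) ↔
      0 < Module.finrank ℚ (LinearMap.ker (Elin n k m)) := by omega
  rw [this, pos_iff_ne_zero, Ne, Submodule.finrank_eq_zero, ← Ne, Submodule.ne_bot_iff]
  constructor
  · rintro ⟨⟨f, hf⟩, h1, h2⟩
    exact ⟨f, hf, fun h0 => h2 (Subtype.ext h0), congrArg Subtype.val h1⟩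
  · rintro ⟨f, hf, h1, h2⟩
    exact ⟨⟨f, hf⟩, Subtype.ext h2, fun h0 => h1 (congrArg Subtype.val h0)⟩

theorem X_zero_pow_mem (n k : ℕ) : (X 0 : Poly n) ^ k ∈ R n k 0 := by
  have := (isWeightedHomogeneous_X ℚ (wt n) 0).pow k
  rw [mem_weightedHomogeneousSubmodule]
  convert! this using 1
  simp [wt]

/-- semigroup property -/
theorem hwv_mul {n : ℕ} {k m k' m' : ℤ}
    (h : ∃ f ∈ R n k m, f ≠ 0 ∧ E n f = 0) (h' : ∃ f ∈ R n k' m', f ≠ 0 ∧ E n f = 0) :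
    ∃ f ∈ R n (k + k') (m + m'), f ≠ 0 ∧ E n f = 0 := by
  obtain ⟨f, hf, h1, h2⟩ := h
  obtain ⟨g, hg, h3, h4⟩ := h'
  refine ⟨f * g, IsWeightedHomogeneous.mul hf hg, mul_ne_zero h1 h3, ?_⟩
  rw [Derivation.leibniz, h2, h4]; simp

theorem hwv_zero (n k : ℕ) : ∃ f ∈ R n k 0, f ≠ 0 ∧ E n f = 0 :=
  ⟨X 0 ^ k, X_zero_pow_mem n k, pow_ne_zero _ (X_ne_zero _), by
    rw [Derivation.leibniz_pow, E_X_zero]; simp⟩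

end PPU

namespace PPU
open MvPolynomial

/-- multisets of `k` naturals, each at most `n`, with sum `m` -/
def Q (k n m : ℕ) : Set (Multiset ℕ) := {s | s.card = k ∧ (∀ j ∈ s, j ≤ n) ∧ s.sum = m}

theorem mem_Q {k n m : ℕ} {s : Multiset ℕ} :
    s ∈ Q k n m ↔ s.card = k ∧ (∀ j ∈ s, j ≤ n) ∧ s.sum = m := Iff.rfl

theorem weight_toFinsupp (n : ℕ) (t : Multiset (Fin (n + 1))) :
    Finsupp.weight (wt n) (Multiset.toFinsupp t)
      = ((t.card : ℤ), (((t.map Fin.val).sum : ℕ) : ℤ)) := by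
  induction t using Multiset.induction_on with
  | empty => simp; rfl
  | cons a t ih =>
    rw [← Multiset.singleton_add, map_add, map_add, ih, Multiset.toFinsupp_singleton,
      Finsupp.weight_single]
    simp [wt, add_comm]

theorem Q_eq_image (k n m : ℕ) :
    Q k n m = (fun d : Fin (n + 1) →₀ ℕ => (Finsupp.toMultiset d).map Fin.val) '' Idx n k m := by
  ext s
  rw [mem_Q, Set.mem_image]
  constructor
  · rintro ⟨h1, h2, h3⟩
    lift s to Multiset (Fin (n + 1)) using (fun j hj => Nat.lt_succ_of_le (h2 j hj)) with t
    refine ⟨Multiset.toFinsupp t, ?_, by simp⟩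
    change Finsupp.weight _ _ = _
    rw [weight_toFinsupp, h3, ← h1]
    simp
  · rintro ⟨d, hd, rfl⟩
    obtain ⟨t, rfl⟩ : ∃ t, d = Multiset.toFinsupp t := ⟨Finsupp.toMultiset d, by simp⟩
    change Finsupp.weight _ _ = _ at hd
    rw [weight_toFinsupp, Prod.mk.injEq] at hd
    obtain ⟨h1, h2⟩ := hd
    simp only [Multiset.toFinsupp_toMultiset]
    refine ⟨by simpa using h1, ?_, by exact_mod_cast h2⟩
    intro j hj
    obtain ⟨i, -, rfl⟩ := Multiset.mem_map.1 hj
    omega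

theorem Q_finite (k n m : ℕ) : (Q k n m).Finite := by
  rw [Q_eq_image]; exact (Idx_finite _ _ _).image _

theorem Idx_ncard (k n m : ℕ) : (Idx n k m).ncard = (Q k n m).ncard := by
  rw [Q_eq_image, Set.ncard_image_of_injective]
  exact (Multiset.map_injective Fin.val_injective).comp Multiset.toFinsupp.symm.injective

theorem p_eq (k n m : ℕ) : p k n m = (Q k n m).ncard := by
  rw [p, ← Nat.card_eq_fintype_card, ← Nat.card_coe_set_eq]
  refine Nat.card_congr
    { toFun := fun π => ⟨π.1.parts + Multiset.replicate (k - π.1.parts.card) 0, ?_, ?_, ?_⟩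
      invFun := fun s => ⟨⟨s.1.filter (· ≠ 0), ?_, ?_⟩, ?_, ?_⟩
      left_inv := ?_
      right_inv := ?_ }
  · have := π.2.1
    simp; omega
  · intro j hj
    rcases Multiset.mem_add.1 hj with h | h
    · exact π.2.2 j h
    · rw [Multiset.eq_of_mem_replicate h]; exact Nat.zero_le _
  · simp [π.1.parts_sum]
  · intro i hi
    exact Nat.pos_of_ne_zero (Multiset.mem_filter.1 hi).2
  · have h := s.2.2.2
    have h2 := Multiset.filter_add_not (fun x : ℕ => x ≠ 0) s.1
    rw [← h2, Multiset.sum_add] at h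
    have : (Multiset.filter (fun x : ℕ => ¬ x ≠ 0) s.1).sum = 0 := by
      apply Multiset.sum_eq_zero
      intro x hx
      simpa using (Multiset.mem_filter.1 hx).2
    omega
  · exact (Multiset.card_le_card (Multiset.filter_le _ _)).trans s.2.1.le
  · intro j hj
    exact s.2.2.1 j (Multiset.mem_filter.1 hj).1
  · rintro ⟨π, h1, h2⟩
    apply Subtype.ext
    apply Nat.Partition.ext
    simp only [Multiset.filter_add]
    rw [Multiset.filter_eq_self.2 (fun a ha => (π.parts_pos ha).ne'), Multiset.filter_eq_nil.2
      (fun a ha => by simp [Multiset.eq_of_mem_replicate ha])]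
    simp
  · rintro ⟨s, h1, h2, h3⟩
    apply Subtype.ext
    simp only
    have h := Multiset.filter_add_not (fun x : ℕ => x ≠ 0) s
    conv_rhs => rw [← h]
    congr 1
    symm
    rw [Multiset.eq_replicate]
    constructor
    · have := congrArg Multiset.card h
      rw [Multiset.card_add] at this
      omega
    · intro b hb
      simpa using (Multiset.mem_filter.1 hb).2

/-- Gaussian coefficient through its Pascal recursion -/
noncomputable def gauss : ℕ → ℕ → Polynomial ℕ
  | 0, _ => 1
  | _ + 1, 0 => 1
  | k + 1, n + 1 => gauss (k + 1) n + Polynomial.X ^ (n + 1) * gauss k (n + 1)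

theorem gauss_zero_right (k : ℕ) : gauss k 0 = 1 := by cases k <;> simp [gauss]
theorem gauss_zero_left (n : ℕ) : gauss 0 n = 1 := by simp [gauss]
theorem gauss_succ (k n : ℕ) : gauss (k + 1) (n + 1)
    = gauss (k + 1) n + Polynomial.X ^ (n + 1) * gauss k (n + 1) := by simp [gauss]

theorem gauss_succ' (N : ℕ) : ∀ k n : ℕ, k + n = N → gauss (k + 1) (n + 1)
    = gauss k (n + 1) + Polynomial.X ^ (k + 1) * gauss (k + 1) n := by
  induction N with
  | zero =>
    intro k n h
    obtain ⟨rfl, rfl⟩ : k = 0 ∧ n = 0 := by omega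
    rw [gauss_succ]; simp [gauss_zero_left, gauss_zero_right]
  | succ N ih =>
    intro k n h
    rcases k with _ | k
    · rcases n with _ | n
      · omega
      have h1 := ih 0 n (by omega)
      have h2 := gauss_succ 0 n
      rw [gauss_succ 0 (n + 1)]
      simp only [gauss_zero_left, zero_add] at h1 h2 ⊢
      rw [h1]
      nth_rewrite 2 [← h1]
      rw [h2]
      ring
    · rcases n with _ | n
      · have h1 := ih k 0 (by omega)
        have h2 := gauss_succ k 0
        rw [gauss_succ (k + 1) 0]
        nth_rewrite 1 [h1]
        rw [h2]
        simp only [gauss_zero_right]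
        ring
      · have h1 := ih (k + 1) n (by omega)
        have h2 := ih k (n + 1) (by omega)
        have h3 := gauss_succ k (n + 1)
        have h4 := gauss_succ (k + 1) n
        rw [gauss_succ (k + 1) (n + 1)]
        nth_rewrite 1 [h1]
        nth_rewrite 1 [h2]
        rw [h3, h4]
        ring

theorem gauss_symm (N : ℕ) : ∀ k n : ℕ, k + n = N → gauss k n = gauss n k := by
  induction N with
  | zero =>
    intro k n h
    obtain ⟨rfl, rfl⟩ : k = 0 ∧ n = 0 := by omega
    rfl
  | succ N ih =>
    intro k n h
    rcases k with _ | k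
    · rw [gauss_zero_left, gauss_zero_right]
    rcases n with _ | n
    · rw [gauss_zero_left, gauss_zero_right]
    rw [gauss_succ, gauss_succ' _ n k rfl, ih (k + 1) n (by omega)]
    congr 1
    rcases N with _ | N
    · omega
    rw [ih k (n + 1) (by omega)]

theorem Q_zero_left (n m : ℕ) : (Q 0 n m).ncard = if m = 0 then 1 else 0 := by
  split_ifs with h
  · subst h
    rw [Set.ncard_eq_one]
    refine ⟨0, Set.ext fun s => ?_⟩
    rw [mem_Q, Set.mem_singleton_iff, Multiset.card_eq_zero]
    constructor
    · exact fun h => h.1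
    · rintro rfl; simp
  · rw [Set.ncard_eq_zero (Q_finite _ _ _), Set.eq_empty_iff_forall_notMem]
    rintro s ⟨h1, -, h3⟩
    rw [Multiset.card_eq_zero] at h1
    subst h1
    exact h h3.symm

theorem Q_zero_right (k m : ℕ) : (Q k 0 m).ncard = if m = 0 then 1 else 0 := by
  split_ifs with h
  · subst h
    rw [Set.ncard_eq_one]
    refine ⟨Multiset.replicate k 0, Set.ext fun s => ?_⟩
    rw [mem_Q, Set.mem_singleton_iff]
    constructor
    · exact fun h => Multiset.eq_replicate.2 ⟨h.1, fun b hb => Nat.le_zero.1 (h.2.1 b hb)⟩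
    · rintro rfl
      exact ⟨by simp, fun j hj => (Multiset.eq_of_mem_replicate hj).le, by simp⟩
  · rw [Set.ncard_eq_zero (Q_finite _ _ _), Set.eq_empty_iff_forall_notMem]
    rintro s ⟨h1, h2, h3⟩
    apply h
    rw [← h3]
    exact Multiset.sum_eq_zero fun b hb => Nat.le_zero.1 (h2 b hb)

theorem Q_succ (k n m : ℕ) : (Q (k + 1) (n + 1) m).ncard = (Q (k + 1) n m).ncard
    + if n + 1 ≤ m then (Q k (n + 1) (m - (n + 1))).ncard else 0 := by
  split_ifs with h
  · have hu : Q (k + 1) (n + 1) m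
        = Q (k + 1) n m ∪ (fun s => (n + 1) ::ₘ s) '' Q k (n + 1) (m - (n + 1)) := by
      ext s
      rw [Set.mem_union, Set.mem_image]
      constructor
      · rintro ⟨h1, h2, h3⟩
        by_cases hs : n + 1 ∈ s
        · right
          obtain ⟨t, rfl⟩ := Multiset.exists_cons_of_mem hs
          refine ⟨t, ⟨by simpa using h1, fun j hj => h2 j (Multiset.mem_cons_of_mem hj), ?_⟩, rfl⟩
          rw [Multiset.sum_cons] at h3
          omega
        · left
          refine ⟨h1, fun j hj => ?_, h3⟩
          have := h2 j hj
          have : j ≠ n + 1 := fun e => hs (e ▸ hj)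
          omega
      · rintro (⟨h1, h2, h3⟩ | ⟨t, ⟨h1, h2, h3⟩, rfl⟩)
        · exact ⟨h1, fun j hj => (h2 j hj).trans (Nat.le_succ n), h3⟩
        · refine ⟨by simp [h1], fun j hj => ?_, ?_⟩
          · rcases Multiset.mem_cons.1 hj with rfl | hj
            · exact le_rfl
            · exact h2 j hj
          · rw [Multiset.sum_cons]; omega
    rw [hu, Set.ncard_union_eq _ (Q_finite _ _ _) ((Q_finite _ _ _).image _),
      Set.ncard_image_of_injective _ (fun s t h => (Multiset.cons_inj_right (n + 1)).1 h)]
    rw [Set.disjoint_left]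
    rintro s ⟨-, h2, -⟩ ⟨t, -, rfl⟩
    have := h2 (n + 1) (Multiset.mem_cons_self _ _)
    omega
  · rw [add_zero]
    congr 1
    ext s
    constructor
    · rintro ⟨h1, h2, h3⟩
      refine ⟨h1, fun j hj => ?_, h3⟩
      have := Multiset.le_sum_of_mem hj
      omega
    · rintro ⟨h1, h2, h3⟩
      exact ⟨h1, fun j hj => (h2 j hj).trans (Nat.le_succ n), h3⟩

theorem gauss_coeff (k n : ℕ) : ∀ m, (gauss k n).coeff m = (Q k n m).ncard := by
  induction k generalizing n with
  | zero => intro m; rw [gauss_zero_left, Q_zero_left, Polynomial.coeff_one]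
  | succ k ihk =>
    induction n with
    | zero => intro m; rw [gauss_zero_right, Q_zero_right, Polynomial.coeff_one]
    | succ n ihn =>
      intro m
      rw [gauss_succ, Q_succ, Polynomial.coeff_add, Polynomial.coeff_X_pow_mul', ihn, ihk]

/-- base of the packed representation of coefficient sequences -/
abbrev B : ℕ := 2147483648

def nextRow : ℕ → ℕ → List ℕ → List ℕ
  | _, _, [] => []
  | n, a, r :: rs => (a + B ^ (n + 1) * r) :: nextRow (n + 1) (a + B ^ (n + 1) * r) rs

def rows : ℕ → List ℕ
  | 0 => List.replicate 15 1
  | k + 1 => nextRow 0 1 (rows k)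

def Rep (N : ℕ) (g : Polynomial ℕ) : Prop := N = g.eval B

theorem rep_step {a r : ℕ} {k n : ℕ} (ha : Rep a (gauss (k + 1) n))
    (hr : Rep r (gauss k (n + 1))) : Rep (a + B ^ (n + 1) * r) (gauss (k + 1) (n + 1)) := by
  unfold Rep at *
  rw [gauss_succ, Polynomial.eval_add, Polynomial.eval_mul, Polynomial.eval_pow,
    Polynomial.eval_X, ← ha, ← hr]

theorem gauss_eval_one (k n : ℕ) : (gauss k n).eval 1 ≤ 2 ^ (k + n) := by
  induction k generalizing n with
  | zero => simpa [gauss_zero_left] using Nat.one_le_two_pow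
  | succ k ihk =>
    induction n with
    | zero => simpa [gauss_zero_right] using Nat.one_le_two_pow
    | succ n ihn =>
      rw [gauss_succ, Polynomial.eval_add, Polynomial.eval_mul, Polynomial.eval_pow,
        Polynomial.eval_X, one_pow, one_mul]
      have := ihk (n + 1)
      rw [show k + 1 + (n + 1) = (k + 1 + n) + 1 by ring, pow_succ]
      rw [show k + (n + 1) = k + 1 + n by ring] at this
      omega

theorem coeff_le_eval_one (g : Polynomial ℕ) (m : ℕ) : g.coeff m ≤ g.eval 1 := by
  rw [Polynomial.eval_eq_sum_range]
  simp only [one_pow, mul_one]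
  by_cases h : m ≤ g.natDegree
  · exact Finset.single_le_sum (f := fun i => g.coeff i) (fun i _ => Nat.zero_le _)
      (Finset.mem_range.2 (Nat.lt_succ_of_le h))
  · rw [Polynomial.coeff_eq_zero_of_natDegree_lt (by omega)]
    exact Nat.zero_le _

theorem rep_div {N : ℕ} {g : Polynomial ℕ} (h : Rep N g) (hg : g.coeff 0 < B) :
    N % B = g.coeff 0 ∧ Rep (N / B) g.divX := by
  unfold Rep at *
  have h1 : N = B * g.divX.eval B + g.coeff 0 := by
    conv_lhs => rw [h, ← Polynomial.divX_mul_X_add g]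
    rw [Polynomial.eval_add, Polynomial.eval_mul, Polynomial.eval_X, Polynomial.eval_C, mul_comm]
  rw [h1]
  constructor
  · rw [Nat.mul_add_mod, Nat.mod_eq_of_lt hg]
  · rw [Nat.mul_add_div (by norm_num), Nat.div_eq_of_lt hg, add_zero]

theorem nextRow_rep (k : ℕ) (rs : List ℕ) : ∀ (n : ℕ) (a : ℕ),
    Rep a (gauss (k + 1) n) →
    (∀ i (hi : i < rs.length), Rep rs[i] (gauss k (n + 1 + i))) →
    ∀ i (hi : i < (nextRow n a rs).length), Rep (nextRow n a rs)[i] (gauss (k + 1) (n + 1 + i)) := by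
  induction rs with
  | nil => intro n a _ _ i hi; simp [nextRow] at hi
  | cons r rs ih =>
    intro n a ha hrs i hi
    have h0 := rep_step ha (hrs 0 (by simp))
    cases i with
    | zero => exact h0
    | succ i =>
      have := ih (n + 1) _ h0 (fun j hj => by
        have := hrs (j + 1) (by simpa using hj)
        rw [show n + 1 + 1 + j = n + 1 + (j + 1) by ring]
        exact this) i (by simpa [nextRow] using hi)
      rw [show n + 1 + (i + 1) = n + 1 + 1 + i by ring]
      exact this

theorem rep_one {g : Polynomial ℕ} (hg : g = 1) : Rep 1 g := by
  unfold Rep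
  rw [hg, Polynomial.eval_one]

theorem rows_rep (k : ℕ) : ∀ i (hi : i < (rows k).length), Rep (rows k)[i] (gauss k (1 + i)) := by
  induction k with
  | zero =>
    intro i hi
    simp only [rows, List.getElem_replicate]
    exact rep_one (gauss_zero_left _)
  | succ k ih =>
    have := nextRow_rep k (rows k) 0 1 (rep_one (gauss_zero_right _)) (by simpa using ih)
    simpa [rows] using this

/-- check strict increase of the first `b + 1` digits -/
def incr : ℕ → ℕ → Bool
  | 0, _ => true
  | b + 1, N => Nat.blt (N % B) (N / B % B) && incr b (N / B)

theorem incr_spec (b : ℕ) : ∀ (N : ℕ) (g : Polynomial ℕ), Rep N g → (∀ m, g.coeff m < B) →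
    incr b N = true → ∀ m < b, g.coeff m < g.coeff (m + 1) := by
  induction b with
  | zero => intro N g _ _ _ m hm; omega
  | succ b ih =>
    intro N g h hg hl m hm
    simp only [incr, Bool.and_eq_true] at hl
    obtain ⟨h1, h2⟩ := rep_div h (hg 0)
    have hg' : ∀ m, g.divX.coeff m < B := fun m => by rw [Polynomial.coeff_divX]; exact hg _
    obtain ⟨h3, -⟩ := rep_div h2 (hg' 0)
    cases m with
    | zero =>
      have h4 := (Iff.of_eq Nat.blt_eq).1 hl.1
      rw [h1, h3, Polynomial.coeff_divX] at h4
      exact h4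
    | succ m =>
      have := ih _ _ h2 hg' hl.2 m (by omega)
      rwa [Polynomial.coeff_divX, Polynomial.coeff_divX] at this

def checkRow (k : ℕ) : ℕ → List ℕ → Bool
  | _, [] => true
  | n, r :: rs => (Nat.blt n 8 || incr (n * k / 2 - 1) (r / B)) && checkRow k (n + 1) rs

theorem checkRow_spec (k : ℕ) (rs : List ℕ) : ∀ n, checkRow k n rs = true →
    ∀ i (hi : i < rs.length), 8 ≤ n + i → incr ((n + i) * k / 2 - 1) (rs[i] / B) = true := by
  induction rs with
  | nil => intro n _ i hi; simp at hi
  | cons r rs ih =>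
    intro n h i hi h8
    simp only [checkRow, Bool.and_eq_true, Bool.or_eq_true] at h
    cases i with
    | zero =>
      rcases h.1 with h1 | h1
      · have := (Iff.of_eq Nat.blt_eq).1 h1; omega
      · exact h1
    | succ i =>
      have := ih (n + 1) h.2 i (by simpa using hi) (by omega)
      rw [show n + (i + 1) = n + 1 + i by ring]
      exact this

def checkAll : ℕ → List ℕ → ℕ → Bool
  | _, _, 0 => true
  | k, r, f + 1 => (Nat.blt k 8 || checkRow k 1 r) && Nat.beq r.length 15
      && checkAll (k + 1) (nextRow 0 1 r) f

theorem checkAll_spec (f : ℕ) : ∀ k, checkAll k (rows k) f = true →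
    ∀ j < f, 8 ≤ k + j → checkRow (k + j) 1 (rows (k + j)) = true ∧ (rows (k + j)).length = 15 := by
  induction f with
  | zero => intro k _ j hj; omega
  | succ f ih =>
    intro k h j hj h8
    simp only [checkAll, Bool.and_eq_true, Bool.or_eq_true] at h
    cases j with
    | zero =>
      refine ⟨?_, Nat.eq_of_beq_eq_true h.1.2⟩
      rcases h.1.1 with h1 | h1
      · have := (Iff.of_eq Nat.blt_eq).1 h1; omega
      · exact h1
    | succ j =>
      have := ih (k + 1) h.2 j (by omega) (by omega)
      rw [show k + (j + 1) = k + 1 + j by ring]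
      exact this

set_option maxRecDepth 100000 in
theorem check_true : checkAll 0 (rows 0) 16 = true := by
  decide +kernel

theorem base {k n m : ℕ} (hk : 8 ≤ k) (hk' : k ≤ 15) (hn : 8 ≤ n) (hn' : n ≤ 15) (hm : 1 ≤ m)
    (h : 2 * (m + 1) ≤ n * k) : (gauss k n).coeff m < (gauss k n).coeff (m + 1) := by
  obtain ⟨h1, h2⟩ := checkAll_spec 16 0 check_true k (by omega) (by omega)
  simp only [zero_add] at h1 h2
  obtain ⟨i, rfl⟩ : ∃ i, n = 1 + i := ⟨n - 1, by omega⟩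
  have hi : i < (rows k).length := by omega
  have h3 := checkRow_spec k _ 1 h1 i hi hn
  obtain ⟨m, rfl⟩ : ∃ m', m = m' + 1 := ⟨m - 1, by omega⟩
  have hB : ∀ m, (gauss k (1 + i)).coeff m < B := fun m =>
    calc _ ≤ _ := coeff_le_eval_one _ m
      _ ≤ 2 ^ (k + (1 + i)) := gauss_eval_one _ _
      _ ≤ 2 ^ 30 := Nat.pow_le_pow_right (by norm_num) (by omega)
      _ < B := by norm_num
  obtain ⟨-, h5⟩ := rep_div (rows_rep k i hi) (hB 0)
  have h4 := incr_spec _ _ _ h5 (fun m => by rw [Polynomial.coeff_divX]; exact hB _) h3 m (by omega)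
  rwa [Polynomial.coeff_divX, Polynomial.coeff_divX] at h4

/-- positivity of the difference at `(k, n, m)` -/
def S (k n m : ℕ) : Prop := ∃ f ∈ R n k m, f ≠ 0 ∧ E n f = 0

theorem S_iff {k n m : ℕ} (h : 2 * (m + 1) ≤ n * k) :
    S k n (m + 1) ↔ (gauss k n).coeff m < (gauss k n).coeff (m + 1) := by
  have h' : (2 * (m + 1) : ℤ) ≤ n * k := by exact_mod_cast h
  rw [gauss_coeff, gauss_coeff, ← Idx_ncard, ← Idx_ncard]
  push_cast
  rw [strict_iff (by omega)]
  simp [S]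

theorem S_add {k k' n m m' : ℕ} (h : S k n m) (h' : S k' n m') : S (k + k') n (m + m') := by
  have := hwv_mul h h'
  unfold S
  push_cast
  exact this

theorem S_symm {k n m : ℕ} (h : 2 * m ≤ n * k) : S k n m ↔ S n k m := by
  cases m with
  | zero => exact iff_of_true (by simpa [S] using hwv_zero n k) (by simpa [S] using hwv_zero k n)
  | succ m => rw [S_iff h, S_iff (by rw [mul_comm k n]; exact h), gauss_symm _ k n rfl]

/-- all required inequalities for the rectangle `k × n` -/
def Good (k n : ℕ) : Prop := ∀ m, 2 ≤ m → 2 * m ≤ n * k → S k n m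

theorem Good.symm {k n : ℕ} (h : Good k n) : Good n k := fun m h2 hm =>
  (S_symm hm).2 (h m h2 (by rw [mul_comm n k]; exact hm))

theorem Good.add {k n : ℕ} (hk : 8 ≤ k) (hn : 8 ≤ n) (h : Good k n) (h8 : Good 8 n) :
    Good (k + 8) n := by
  intro m h2 hm
  have hnk : 64 ≤ n * k := by nlinarith
  by_cases h1 : 2 * m ≤ n * k
  · exact S_add (m' := 0) (h m h2 h1) (by simpa [S] using hwv_zero n 8)
  · rw [mul_add] at hm
    by_cases h3 : m = n * k / 2 + 1
    · have := S_add (h (m - 2) (by omega) (by omega)) (h8 2 le_rfl (by omega))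
      rwa [Nat.sub_add_cancel h2] at this
    · have := S_add (h (n * k / 2) (by omega) (by omega))
        (h8 (m - n * k / 2) (by omega) (by omega))
      rwa [Nat.add_sub_cancel' (by omega)] at this

theorem good_base {k n : ℕ} (hk : 8 ≤ k) (hk' : k ≤ 15) (hn : 8 ≤ n) (hn' : n ≤ 15) : Good k n := by
  intro m h2 hm
  obtain ⟨m, rfl⟩ : ∃ m', m = m' + 1 := ⟨m - 1, by omega⟩
  exact (S_iff hm).2 (base hk hk' hn hn' (by omega) hm)

theorem good_ext {n : ℕ} (hn : 8 ≤ n) (h : ∀ k, 8 ≤ k → k ≤ 15 → Good k n) :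
    ∀ k, 8 ≤ k → Good k n := by
  intro k
  induction k using Nat.strong_induction_on with
  | _ k ih =>
    intro hk
    by_cases h15 : k ≤ 15
    · exact h k hk h15
    · have := (ih (k - 8) (by omega) (by omega)).add (by omega) hn (h 8 le_rfl (by omega))
      rwa [Nat.sub_add_cancel hk] at this

theorem good_all {k n : ℕ} (hk : 8 ≤ k) (hn : 8 ≤ n) : Good k n := by
  refine good_ext hn (fun k hk hk' => Good.symm ?_) k hk
  exact good_ext hk (fun n hn hn' => good_base hn hn' hk hk') n hn

end PPU

/-- Pak–Panova strict unimodality of the Gaussian coefficients: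
for $n, k ≥ 8$ and $2 ≤ m ≤ nk/2$, $p(k,n,m) - p(k,n,m-1) ≥ 1$. -/
theorem pak_panova_strict_unimodality (n k m : ℕ) (hn : 8 ≤ n) (hk : 8 ≤ k)
    (hm2 : 2 ≤ m) (hm : 2 * m ≤ n * k) :
    p k n (m - 1) + 1 ≤ p k n m := by
  have h := PPU.good_all hk hn m hm2 hm
  obtain ⟨m, rfl⟩ : ∃ m', m = m' + 1 := ⟨m - 1, by omega⟩
  rw [PPU.S_iff hm, PPU.gauss_coeff, PPU.gauss_coeff, ← PPU.p_eq, ← PPU.p_eq] at h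
  exact h
end

section
/- Let n, r ≥ 8 with at least one of n, r even, and let k ≥ r and nr/2 ≤ m ≤ nk/2. Then p(k,n,m) − p(k,n,m−1) > p(k−r,n,m−nr/2) − p(k−r,n,m−nr/2−1), with p(j,n,−1) = 0 by convention. -/
/-- `p` extended to integer `m`, with value `0` for negative `m`. -/
def pZ (k n : ℕ) (m : ℤ) : ℕ := if 0 ≤ m then p k n m.toNat else 0

namespace GKey

/-- Coefficients of the Gaussian polynomials, by their Pascal-type recursion. -/
def g : ℕ → ℕ → ℤ → ℕ
  | 0, _, m => if m = 0 then 1 else 0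
  | _ + 1, 0, m => if m = 0 then 1 else 0
  | k + 1, n + 1, m => g (k + 1) n m + g k (n + 1) (m - (n + 1))
termination_by k n => k + n

lemma g_zero_left (n : ℕ) (m : ℤ) : g 0 n m = if m = 0 then 1 else 0 := by simp [g]
lemma g_zero_right (k : ℕ) (m : ℤ) : g k 0 m = if m = 0 then 1 else 0 := by
  cases k <;> simp [g]
lemma g_succ (k n : ℕ) (m : ℤ) :
    g (k + 1) (n + 1) m = g (k + 1) n m + g k (n + 1) (m - (n + 1)) := by rw [g]

lemma g_succ' (N : ℕ) : ∀ (k n : ℕ) (_ : k + n = N) (m : ℤ),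
    g (k + 1) (n + 1) m = g k (n + 1) m + g (k + 1) n (m - (k + 1)) := by
  induction N using Nat.strong_induction_on with
  | _ N ih =>
    intro k n hN m
    rw [g_succ]
    rcases k with _ | k <;> rcases n with _ | n
    · simp [g_zero_left, g_zero_right]
    · rw [ih (0 + n) (by omega) 0 n rfl, g_succ 0 n]
      simp only [g_zero_left]
      have : m - ((0 : ℕ) + 1) - (n + 1) = m - ((n + 1 : ℕ) + 1) := by push_cast; ring
      rw [this]; ring
    · rw [ih (k + 0) (by omega) k 0 rfl, g_succ k 0]
      simp only [g_zero_right]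
      have : m - ((0 : ℕ) + 1) - (k + 1) = m - ((k + 1 : ℕ) + 1) := by push_cast; ring
      rw [this]; ring
    · rw [ih (k + 1 + n) (by omega) (k + 1) n rfl, ih (k + (n + 1)) (by omega) k (n + 1) rfl,
        g_succ k (n + 1) m, g_succ (k + 1) n]
      have : m - ((n + 1 : ℕ) + 1) - (k + 1) = m - ((k + 1 : ℕ) + 1) - (n + 1) := by
        push_cast; ring
      rw [this]; ring

lemma g_symm (k n : ℕ) (m : ℤ) : g k n m = g n k m := by
  induction k generalizing n m with
  | zero => rw [g_zero_left, g_zero_right]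
  | succ k ihk =>
    induction n generalizing m with
    | zero => rw [g_zero_left, g_zero_right]
    | succ n ihn => rw [g_succ, g_succ' (n + k) n k rfl, ihn, ihk]

lemma g_neg (k n : ℕ) (m : ℤ) (hm : m < 0) : g k n m = 0 := by
  induction k generalizing n m with
  | zero => rw [g_zero_left, if_neg hm.ne]
  | succ k ihk =>
    induction n generalizing m with
    | zero => rw [g_zero_right, if_neg hm.ne]
    | succ n ihn => rw [g_succ, ihn _ hm, ihk _ _ (by omega)]

lemma g_at_zero (k n : ℕ) : g k n 0 = 1 := by
  induction k generalizing n with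
  | zero => simp [g_zero_left]
  | succ k ihk =>
    induction n with
    | zero => simp [g_zero_right]
    | succ n ihn => rw [g_succ, ihn, g_neg _ _ _ (by omega)]

/-- Multisets of `k` numbers, each at most `n`, with sum `m`. -/
def T (k n : ℕ) (m : ℤ) : Set (Multiset ℕ) :=
  {M | M.card = k ∧ (∀ x ∈ M, x ≤ n) ∧ (M.sum : ℤ) = m}

lemma T_zero_left (n : ℕ) (m : ℤ) : T 0 n m = if m = 0 then {0} else ∅ := by
  ext M
  split_ifs with h
  · simp only [T, Set.mem_ofPred_eq, Multiset.card_eq_zero, Set.mem_singleton_iff]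
    constructor
    · exact fun h => h.1
    · rintro rfl; simp [h]
  · simp only [T, Set.mem_ofPred_eq, Multiset.card_eq_zero, Set.mem_empty_iff_false, iff_false]
    rintro ⟨rfl, -, h2⟩
    exact h (by simpa using h2.symm)

lemma T_zero_right (k : ℕ) (m : ℤ) :
    T k 0 m = if m = 0 then {Multiset.replicate k 0} else ∅ := by
  ext M
  have key : (M.card = k ∧ ∀ x ∈ M, x ≤ 0) ↔ M = Multiset.replicate k 0 := by
    rw [Multiset.eq_replicate]; simp
  split_ifs with h
  · simp only [T, Set.mem_ofPred_eq, Set.mem_singleton_iff]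
    rw [← and_assoc, key]
    constructor
    · exact fun h => h.1
    · rintro rfl; simp [h]
  · simp only [T, Set.mem_ofPred_eq, Set.mem_empty_iff_false, iff_false]
    rw [← and_assoc, key]
    rintro ⟨rfl, h2⟩
    exact h (by simpa using h2.symm)

lemma T_succ (k n : ℕ) (m : ℤ) :
    T (k + 1) (n + 1) m = T (k + 1) n m ∪ (Multiset.cons (n + 1)) '' T k (n + 1) (m - (n + 1)) := by
  ext M
  simp only [T, Set.mem_union, Set.mem_image, Set.mem_ofPred_eq]
  constructor
  · rintro ⟨h1, h2, h3⟩
    by_cases hM : n + 1 ∈ M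
    · right
      obtain ⟨M', rfl⟩ := Multiset.exists_cons_of_mem hM
      refine ⟨M', ⟨by simpa using h1, fun x hx => h2 x (Multiset.mem_cons_of_mem hx), ?_⟩, rfl⟩
      rw [← h3]; simp
    · left
      refine ⟨h1, fun x hx => ?_, h3⟩
      have := h2 x hx
      have : x ≠ n + 1 := by rintro rfl; exact hM hx
      omega
  · rintro (⟨h1, h2, h3⟩ | ⟨M', ⟨h1, h2, h3⟩, rfl⟩)
    · exact ⟨h1, fun x hx => (h2 x hx).trans (by omega), h3⟩
    · refine ⟨by simp [h1], ?_, by simp [h3]⟩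
      intro x hx
      rcases Multiset.mem_cons.1 hx with rfl | hx
      · exact le_rfl
      · exact h2 x hx

lemma T_card (k n : ℕ) (m : ℤ) : (T k n m).Finite ∧ (T k n m).ncard = g k n m := by
  induction k generalizing n m with
  | zero => rw [T_zero_left, g_zero_left]; split_ifs <;> simp
  | succ k ihk =>
    induction n generalizing m with
    | zero => rw [T_zero_right, g_zero_right]; split_ifs <;> simp
    | succ n ihn =>
      have inj : Function.Injective (Multiset.cons (n + 1)) := fun a b h => (Multiset.cons_inj_right _).1 h
      have hf := (ihk (n + 1) (m - (n + 1))).1.image (Multiset.cons (n + 1))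
      rw [T_succ, g_succ, Set.ncard_union_eq ?_ (ihn m).1 hf, Set.ncard_image_of_injective _ inj,
        (ihn m).2, (ihk _ _).2]
      · exact ⟨(ihn m).1.union hf, rfl⟩
      · rw [Set.disjoint_left]
        rintro _ h1 ⟨M', -, rfl⟩
        have := h1.2.1 (n + 1) (Multiset.mem_cons_self _ _)
        omega

lemma p_eq (k n m : ℕ) : p k n m = g k n m := by
  rw [← (T_card k n m).2, p, ← Nat.card_eq_fintype_card, ← Nat.card_coe_set_eq]
  refine Nat.card_eq_of_bijective (fun π => ⟨π.1.parts +
    Multiset.replicate (k - π.1.parts.card) 0, ?_, ?_, ?_⟩) ⟨?_, ?_⟩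
  · have := π.2.1
    simp; omega
  · intro x hx
    rcases Multiset.mem_add.1 hx with hx | hx
    · exact π.2.2 x hx
    · rw [Multiset.eq_of_mem_replicate hx]; omega
  · simp [π.1.parts_sum]
  · rintro ⟨π, hπ⟩ ⟨π', hπ'⟩ h
    have h' := congrArg (Multiset.filter (· ≠ 0)) (congrArg Subtype.val h)
    dsimp only at h'
    have aux : ∀ (ρ : Nat.Partition m) (c : ℕ),
        Multiset.filter (· ≠ 0) (ρ.parts + Multiset.replicate c 0) = ρ.parts := by
      intro ρ c
      rw [Multiset.filter_add, Multiset.filter_eq_self.2, Multiset.filter_eq_nil.2]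
      · simp
      · intro a ha; simp [Multiset.eq_of_mem_replicate ha]
      · intro a ha; exact (ρ.parts_pos ha).ne'
    rw [aux, aux] at h'
    exact Subtype.ext (Nat.Partition.ext h')
  · rintro ⟨M, h1, h2, h3⟩
    have hz : M.filter (· = 0) = Multiset.replicate (M.filter (· = 0)).card 0 := by
      rw [Multiset.eq_replicate]; simp
    have hsplit := Multiset.filter_add_not (· ≠ 0) M
    simp only [not_not] at hsplit
    have hc := congrArg Multiset.card hsplit
    rw [Multiset.card_add] at hc
    have hs := congrArg Multiset.sum hsplit
    rw [Multiset.sum_add] at hs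
    have hz0 : (M.filter (· = 0)).sum = 0 := by rw [hz]; simp
    refine ⟨⟨⟨M.filter (· ≠ 0), ?_, ?_⟩, ?_, ?_⟩, ?_⟩
    · intro i hi; exact Nat.pos_of_ne_zero (Multiset.mem_filter.1 hi).2
    · have : M.sum = m := by exact_mod_cast h3
      omega
    · simp only; omega
    · intro j hj; exact h2 j (Multiset.mem_filter.1 hj).1
    · apply Subtype.ext
      dsimp only
      have : k - (M.filter (· ≠ 0)).card = (M.filter (· = 0)).card := by omega
      rw [this, ← hz, hsplit]

lemma pZ_eq (k n : ℕ) (m : ℤ) : pZ k n m = g k n m := by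
  unfold pZ
  split_ifs with h
  · rw [p_eq, Int.toNat_of_nonneg h]
  · rw [g_neg _ _ _ (by omega)]

/-! ### Computation of small cases -/

def padd : List ℕ → List ℕ → List ℕ
  | [], b => b
  | a :: as, [] => a :: as
  | a :: as, b :: bs => (a + b) :: padd as bs

lemma padd_getD (a b : List ℕ) (m : ℕ) : (padd a b).getD m 0 = a.getD m 0 + b.getD m 0 := by
  induction a generalizing b m with
  | nil => simp [padd]
  | cons x a ih =>
    cases b with
    | nil => simp [padd]
    | cons y b =>
      cases m with
      | zero => simp [padd]
      | succ m => simpa [padd] using ih b m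

def shift : ℕ → List ℕ → List ℕ
  | 0, a => a
  | n + 1, a => 0 :: shift n a

def nextRow : ℕ → List ℕ → List (List ℕ) → List (List ℕ)
  | _, _, [] => []
  | n, prev, q :: qs => padd prev (shift (n + 1) q) ::
      nextRow (n + 1) (padd prev (shift (n + 1) q)) qs

def row : ℕ → List (List ℕ)
  | 0 => List.replicate 15 [1]
  | k + 1 => nextRow 0 [1] (row k)

def Rep (k n : ℕ) (q : List ℕ) : Prop := ∀ m : ℕ, q.getD m 0 = g k n m

def Ok (k : ℕ) : ℕ → List (List ℕ) → Prop
  | _, [] => True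
  | n, q :: qs => Rep k (n + 1) q ∧ Ok k (n + 1) qs

lemma shift_getD (s : ℕ) (q : List ℕ) (k n : ℕ) (h : Rep k n q) (m : ℕ) :
    (shift s q).getD m 0 = g k n ((m : ℤ) - s) := by
  induction s generalizing m with
  | zero => simpa [shift] using h m
  | succ s ih =>
    cases m with
    | zero => rw [g_neg _ _ _ (by push_cast; omega)]; simp [shift]
    | succ m =>
      have := ih m
      simp only [shift, List.getD_cons_succ, this]
      congr 1; push_cast; ring

lemma nextRow_ok (k : ℕ) (qs : List (List ℕ)) : ∀ (n : ℕ) (prev : List ℕ),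
    Rep (k + 1) n prev → Ok k n qs → Ok (k + 1) n (nextRow n prev qs) := by
  induction qs with
  | nil => intros; trivial
  | cons q qs ih =>
    intro n prev hp hq
    have : Rep (k + 1) (n + 1) (padd prev (shift (n + 1) q)) := by
      intro m
      rw [padd_getD, hp m, shift_getD _ _ _ _ hq.1, g_succ]
      push_cast; rfl
    exact ⟨this, ih _ _ this hq.2⟩

lemma rep_one_left (n : ℕ) : Rep 0 n [1] := by
  intro m; rw [g_zero_left]; cases m <;> simp; omega

lemma rep_one_right (n : ℕ) : Rep n 0 [1] := by
  intro m; rw [g_zero_right]; cases m <;> simp; omega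

lemma row_ok (k : ℕ) : Ok k 0 (row k) := by
  induction k with
  | zero =>
    have : ∀ c n, Ok 0 n (List.replicate c [1]) := by
      intro c
      induction c with
      | zero => intro n; trivial
      | succ c ih => intro n; exact ⟨rep_one_left _, ih _⟩
    exact this _ _
  | succ k ih => exact nextRow_ok k _ 0 [1] (rep_one_right _) ih

/-- The property propagated by the induction: strict unimodality and gap two in the middle. -/
def P (n k : ℕ) : Prop :=
  (∀ m : ℕ, 2 ≤ m → 2 * m ≤ n * k → g k n ((m : ℤ) - 1) < g k n m) ∧
  (∀ m : ℕ, 2 * m = n * k → g k n ((m : ℤ) - 1) + 2 ≤ g k n m)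

lemma P_symm {n k : ℕ} (h : P n k) : P k n := by
  refine ⟨fun m h1 h2 => ?_, fun m h1 => ?_⟩
  · rw [g_symm n k, g_symm n k]; exact h.1 m h1 (by rw [mul_comm n k]; exact h2)
  · rw [g_symm n k, g_symm n k]; exact h.2 m (by rw [mul_comm n k]; exact h1)

/-- `chk N m a q`: with `a` the coefficient before the head of `q`, whose index is `m`,
verify the gaps up to index `N / 2`. -/
def chk (N : ℕ) : ℕ → ℕ → List ℕ → Bool
  | m, _, [] => Nat.blt N (2 * m)
  | m, a, b :: q => (Nat.blt N (2 * m)) ||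
      ((Nat.blt a b || Nat.blt m 2) && (Nat.ble (a + 2) b || Nat.blt (2 * m) N) &&
        chk N (m + 1) b q)

lemma chk_sound (N : ℕ) (q : List ℕ) : ∀ (m a : ℕ), chk N m a q = true → ∀ j, 2 * (m + j) ≤ N →
    ((2 ≤ m + j → (a :: q).getD j 0 < (a :: q).getD (j + 1) 0) ∧
     (2 * (m + j) = N → (a :: q).getD j 0 + 2 ≤ (a :: q).getD (j + 1) 0)) := by
  induction q with
  | nil => intro m a h j hj; simp [chk] at h; omega
  | cons b q ih =>
    intro m a h j hj
    have h0 : ¬ (N < 2 * m) := by omega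
    simp only [chk, Bool.or_eq_true, Bool.and_eq_true, Nat.blt_eq, Nat.ble_eq, h0, false_or] at h
    obtain ⟨⟨h1, h2⟩, h3⟩ := h
    cases j with
    | zero => simp; omega
    | succ j =>
      have := ih (m + 1) b h3 j (by omega)
      simp only [List.getD_cons_succ] at this ⊢
      rw [show m + (j + 1) = m + 1 + j by ring]
      exact this

def chkRow (k : ℕ) : ℕ → List (List ℕ) → Bool
  | _, [] => true
  | n, q :: qs => (Nat.blt (n + 1) 8 || chk ((n + 1) * k) 0 0 q) && chkRow k (n + 1) qs

lemma chkRow_sound (k : ℕ) (qs : List (List ℕ)) : ∀ n, Ok k n qs → chkRow k n qs = true →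
    ∀ j, n < j → j ≤ n + qs.length → 8 ≤ j → P j k := by
  induction qs with
  | nil => intro n _ _ j h1 h2; simp at h2; omega
  | cons q qs ih =>
    intro n hok hc j h1 h2 h8
    simp only [chkRow, Bool.or_eq_true, Bool.and_eq_true, Nat.blt_eq] at hc
    rcases Nat.lt_or_ge (n + 1) j with h | h
    · exact ih (n + 1) hok.2 hc.2 j h (by simp at h2; omega) h8
    · obtain rfl : j = n + 1 := by omega
      have hc1 := hc.1.resolve_left (by omega)
      have hs := chk_sound _ _ _ _ hc1
      have hrep := hok.1
      refine ⟨fun m hm hmN => ?_, fun m hm => ?_⟩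
      · obtain ⟨m, rfl⟩ : ∃ m', m = m' + 1 := ⟨m - 1, by omega⟩
        have := (hs (m + 1) (by omega)).1 (by omega)
        simp only [List.getD_cons_succ] at this
        rw [hrep, hrep] at this
        simpa using this
      · have hpos : 0 < (n + 1) * k ∨ k = 0 := by
          rcases Nat.eq_zero_or_pos k with h | h
          · exact Or.inr h
          · exact Or.inl (by positivity)
        rcases Nat.eq_zero_or_pos m with rfl | hm0
        · have := (hs 0 (by omega)).2 (by omega)
          simp only [List.getD_cons_succ, List.getD_cons_zero] at this
          rw [hrep] at this
          rw [g_neg _ _ _ (by simp)]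
          exact this
        · obtain ⟨m, rfl⟩ : ∃ m', m = m' + 1 := ⟨m - 1, by omega⟩
          have := (hs (m + 1) (by omega)).2 (by omega)
          simp only [List.getD_cons_succ] at this
          rw [hrep, hrep] at this
          simpa using this

lemma row_length (k : ℕ) : (row k).length = 15 := by
  have : ∀ (qs : List (List ℕ)) n prev, (nextRow n prev qs).length = qs.length := by
    intro qs
    induction qs with
    | nil => intros; rfl
    | cons q qs ih => intros; simp [nextRow, ih]
  induction k with
  | zero => simp [row]
  | succ k ih => rw [row, this, ih]

def chkAll : ℕ → ℕ → List (List ℕ) → Bool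
  | 0, _, _ => true
  | c + 1, k, r => (Nat.blt k 8 || chkRow k 0 r) && chkAll c (k + 1) (nextRow 0 [1] r)

lemma chkAll_sound (c : ℕ) : ∀ k, chkAll c k (row k) = true → ∀ j, k ≤ j → j < k + c → 8 ≤ j →
    chkRow j 0 (row j) = true := by
  induction c with
  | zero => intros; omega
  | succ c ih =>
    intro k h j h1 h2 h3
    simp only [chkAll, Bool.or_eq_true, Bool.and_eq_true, Nat.blt_eq] at h
    rcases Nat.lt_or_ge k j with hj | hj
    · exact ih (k + 1) h.2 j hj (by omega) h3
    · obtain rfl : j = k := by omega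
      exact h.1.resolve_left (by omega)

lemma chkAll_true : chkAll 16 0 (row 0) = true := by decide +kernel

lemma P_base (n k : ℕ) (hn : 8 ≤ n) (hn' : n ≤ 15) (hk : 8 ≤ k) (hk' : k ≤ 15) : P n k :=
  chkRow_sound k _ 0 (row_ok k) (chkAll_sound 16 0 chkAll_true k (by omega) (by omega) hk) n
    (by omega) (by rw [row_length]; omega) hn

/-! ### Semi-invariants of binary forms -/

open MvPolynomial

lemma mul_le {R : Type*} [CommRing R] [IsDomain R] [Algebra ℂ R] (A B W : Submodule ℂ R)
    [FiniteDimensional ℂ W] (h : ∀ a ∈ A, ∀ b ∈ B, a * b ∈ W) (hA : 1 ≤ Module.finrank ℂ A) :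
    Module.finrank ℂ B ≤ Module.finrank ℂ W := by
  have : FiniteDimensional ℂ A := Module.finite_of_finrank_pos (by omega)
  obtain ⟨a, ha⟩ := (Module.finrank_pos_iff_exists_ne_zero (R := ℂ) (M := A)).1 hA
  have ha0 : (a : R) ≠ 0 := fun h0 => ha (Subtype.ext h0)
  let φ : B →ₗ[ℂ] W := ((LinearMap.mulLeft ℂ (a : R)).comp B.subtype).codRestrict W
    (fun b => h a a.2 b b.2)
  apply LinearMap.finrank_le_finrank_of_injective (f := φ)
  intro b b' hb
  have : (a : R) * b = a * b' := congrArg Subtype.val hb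
  exact Subtype.ext (mul_left_cancel₀ ha0 this)

lemma mul_lt {R : Type*} [CommRing R] [IsDomain R] [Algebra ℂ R] (A B W : Submodule ℂ R)
    [FiniteDimensional ℂ W] (h : ∀ a ∈ A, ∀ b ∈ B, a * b ∈ W) (hA : 2 ≤ Module.finrank ℂ A)
    (hB : 1 ≤ Module.finrank ℂ B) :
    Module.finrank ℂ B < Module.finrank ℂ W := by
  refine lt_of_le_of_ne (mul_le A B W h (by omega)) fun heq => ?_
  have : FiniteDimensional ℂ B := Module.finite_of_finrank_pos (by omega)
  let φ : A → (B →ₗ[ℂ] W) := fun a =>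
    ((LinearMap.mulLeft ℂ (a : R)).comp B.subtype).codRestrict W (fun b => h a a.2 b b.2)
  have hφ : ∀ a b, ((φ a b : W) : R) = a * b := fun a b => rfl
  have hinj : ∀ a, a ≠ 0 → Function.Injective (φ a) := by
    intro a ha b b' hb
    have ha0 : (a : R) ≠ 0 := fun h0 => ha (Subtype.ext h0)
    have : (a : R) * b = a * b' := congrArg Subtype.val hb
    exact Subtype.ext (mul_left_cancel₀ ha0 this)
  have : FiniteDimensional ℂ A := Module.finite_of_finrank_pos (by omega)
  obtain ⟨a, ha⟩ := (Module.finrank_pos_iff_exists_ne_zero (R := ℂ) (M := A)).1 (by omega)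
  obtain ⟨b₀, hb₀⟩ := (Module.finrank_pos_iff_exists_ne_zero (R := ℂ) (M := B)).1 (by omega)
  have : Nontrivial B := ⟨b₀, 0, hb₀⟩
  let e : B ≃ₗ[ℂ] W := LinearEquiv.ofInjectiveOfFinrankEq (φ a) (hinj a ha) heq
  have he : ∀ b, e b = φ a b := fun b => rfl
  -- every element of `A` is a multiple of `a`
  have hmul : ∀ a' : A, ∃ c : ℂ, c • a = a' := by
    intro a'
    obtain ⟨c, hc⟩ := Module.End.exists_eigenvalue ((e.symm : W →ₗ[ℂ] B).comp (φ a'))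
    obtain ⟨b, hb⟩ := hc.exists_hasEigenvector
    refine ⟨c, ?_⟩
    have h1 : e.symm (φ a' b) = c • b := hb.apply_eq_smul
    have h2 : φ a' b = e (c • b) := by rw [← h1, LinearEquiv.apply_symm_apply]
    rw [he] at h2
    have h3 := congrArg Subtype.val h2
    rw [hφ, hφ] at h3
    have hb0 : (b : R) ≠ 0 := fun h0 => hb.2 (Subtype.ext h0)
    apply Subtype.ext
    apply mul_right_cancel₀ hb0
    rw [h3]
    simp
  have := finrank_le_one a hmul
  omega

/-- Bidegree (degree, weight) of the variables. -/
def wt (n : ℕ) : Fin (n + 1) → ℤ × ℤ := fun i => (1, (i : ℤ))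

/-- Forms of degree `k` and weight `m`. -/
noncomputable def V (n k : ℕ) (m : ℤ) : Submodule ℂ (MvPolynomial (Fin (n + 1)) ℂ) :=
  weightedHomogeneousSubmodule ℂ (wt n) ((k : ℤ), m)

lemma mem_V {n k : ℕ} {m : ℤ} {f : MvPolynomial (Fin (n + 1)) ℂ} :
    f ∈ V n k m ↔ IsWeightedHomogeneous (wt n) f ((k : ℤ), m) := Iff.rfl

lemma weight_wt (n : ℕ) (d : Fin (n + 1) →₀ ℕ) :
    Finsupp.weight (wt n) d = ((((Finsupp.toMultiset d).map Fin.val).card : ℤ),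
      (((Finsupp.toMultiset d).map Fin.val).sum : ℤ)) := by
  induction d using Finsupp.induction_linear with
  | zero => simp; rfl
  | add f g hf hg => simp [hf, hg]
  | single a b =>
    rw [Finsupp.weight_single]
    simp [wt, Finsupp.toMultiset_single, Multiset.map_nsmul, Multiset.sum_nsmul]

lemma T_eq_image (n k : ℕ) (m : ℤ) :
    T k n m = (fun d : Fin (n + 1) →₀ ℕ => (Finsupp.toMultiset d).map Fin.val) ''
      {d | Finsupp.weight (wt n) d = ((k : ℤ), m)} := by
  ext M
  simp only [T, Set.mem_image, Set.mem_ofPred_eq, weight_wt, Prod.mk.injEq, Nat.cast_inj]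
  constructor
  · rintro ⟨h1, h2, h3⟩
    have hM : (M.pmap (fun x h => (⟨x, h⟩ : Fin (n + 1)))
        (fun x hx => Nat.lt_succ_of_le (h2 x hx))).map Fin.val = M := by
      rw [Multiset.map_pmap, Multiset.pmap_eq_map (f := fun x => x), Multiset.map_id']
    refine ⟨Multiset.toFinsupp (M.pmap (fun x h => (⟨x, h⟩ : Fin (n + 1)))
        (fun x hx => Nat.lt_succ_of_le (h2 x hx))), ?_, ?_⟩
    · rw [Multiset.toFinsupp_toMultiset, hM]; exact ⟨h1, h3⟩
    · rw [Multiset.toFinsupp_toMultiset, hM]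
  · rintro ⟨d, ⟨h1, h2⟩, rfl⟩
    refine ⟨h1, fun x hx => ?_, h2⟩
    obtain ⟨i, -, rfl⟩ := Multiset.mem_map.1 hx
    omega

lemma weight_set_card (n k : ℕ) (m : ℤ) :
    {d : Fin (n + 1) →₀ ℕ | Finsupp.weight (wt n) d = ((k : ℤ), m)}.Finite ∧
    {d : Fin (n + 1) →₀ ℕ | Finsupp.weight (wt n) d = ((k : ℤ), m)}.ncard = g k n m := by
  have inj : Function.Injective
      (fun d : Fin (n + 1) →₀ ℕ => (Finsupp.toMultiset d).map Fin.val) := by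
    intro d d' h
    exact (Multiset.toFinsupp (α := Fin (n + 1))).symm.injective
      (Multiset.map_injective Fin.val_injective h)
  have := T_card k n m
  rw [T_eq_image] at this
  rw [Set.ncard_image_of_injective _ inj] at this
  exact ⟨this.1.of_finite_image inj.injOn, this.2⟩

lemma V_finrank (n k : ℕ) (m : ℤ) :
    FiniteDimensional ℂ (V n k m) ∧ Module.finrank ℂ (V n k m) = g k n m := by
  obtain ⟨h1, h2⟩ := weight_set_card n k m
  have := h1.to_subtype
  have hV : V n k m = restrictSupport ℂ
      {d : Fin (n + 1) →₀ ℕ | Finsupp.weight (wt n) d = ((k : ℤ), m)} :=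
    weightedHomogeneousSubmodule_eq_finsupp_supported _ _ _
  rw [hV]
  have b := basisRestrictSupport ℂ
    {d : Fin (n + 1) →₀ ℕ | Finsupp.weight (wt n) d = ((k : ℤ), m)}
  exact ⟨Module.Finite.of_basis b, by rw [Module.finrank_eq_nat_card_basis b,
    Nat.card_coe_set_eq, h2]⟩

instance (n k : ℕ) (m : ℤ) : FiniteDimensional ℂ (V n k m) := (V_finrank n k m).1

/-- Variables with natural index, zero out of range. -/
noncomputable def y (n j : ℕ) : MvPolynomial (Fin (n + 1)) ℂ :=
  if h : j < n + 1 then X ⟨j, h⟩ else 0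

/-- Lowering derivation. -/
noncomputable def D (n : ℕ) : Derivation ℂ (MvPolynomial (Fin (n + 1)) ℂ)
    (MvPolynomial (Fin (n + 1)) ℂ) :=
  mkDerivation ℂ fun i => ((i : ℕ) : ℂ) • y n (i - 1)

/-- Raising derivation. -/
noncomputable def U (n : ℕ) : Derivation ℂ (MvPolynomial (Fin (n + 1)) ℂ)
    (MvPolynomial (Fin (n + 1)) ℂ) :=
  mkDerivation ℂ fun i => ((n : ℂ) - ((i : ℕ) : ℂ)) • y n (i + 1)

lemma y_fin (n : ℕ) (i : Fin (n + 1)) : y n i = X i := by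
  rw [y, dif_pos i.2]

lemma D_y (n j : ℕ) (hj : j ≤ n) : D n (y n j) = (j : ℂ) • y n (j - 1) := by
  rw [show j = ((⟨j, by omega⟩ : Fin (n + 1)) : ℕ) from rfl, y_fin, D, mkDerivation_X]

lemma U_y (n j : ℕ) (hj : j ≤ n) : U n (y n j) = ((n : ℂ) - j) • y n (j + 1) := by
  rw [show j = ((⟨j, by omega⟩ : Fin (n + 1)) : ℕ) from rfl, y_fin, U, mkDerivation_X]

lemma y_hom (n j : ℕ) : IsWeightedHomogeneous (wt n) (y n j) ((1, (j : ℤ)) : ℤ × ℤ) := by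
  unfold y
  split_ifs with h
  · exact isWeightedHomogeneous_X ℂ (wt n) ⟨j, h⟩
  · exact isWeightedHomogeneous_zero _ _ _

lemma deriv_hom {n : ℕ} (E : Derivation ℂ (MvPolynomial (Fin (n + 1)) ℂ)
    (MvPolynomial (Fin (n + 1)) ℂ)) (δ a : ℤ × ℤ)
    (hE : ∀ i, IsWeightedHomogeneous (wt n) (E (X i)) (wt n i + δ))
    (f : MvPolynomial (Fin (n + 1)) ℂ) (hf : IsWeightedHomogeneous (wt n) f a) :
    IsWeightedHomogeneous (wt n) (E f) (a + δ) := by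
  have hsum : ∀ (F : Fin (n + 1) → Derivation ℂ (MvPolynomial (Fin (n + 1)) ℂ)
      (MvPolynomial (Fin (n + 1)) ℂ)) (q : MvPolynomial (Fin (n + 1)) ℂ),
      (∑ i, F i) q = ∑ i, F i q := by
    intro F q
    have : ∀ s : Finset (Fin (n + 1)), (∑ i ∈ s, F i) q = ∑ i ∈ s, F i q := by
      intro s
      induction s using Finset.induction_on with
      | empty => simp
      | insert a s ha ih => rw [Finset.sum_insert ha, Finset.sum_insert ha, Derivation.add_apply, ih]
    exact this _
  have key : E f = ∑ i, pderiv i f * E (X i) := by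
    have : E = ∑ i, E (X i) • pderiv (R := ℂ) i := by
      apply derivation_ext
      intro j
      rw [hsum, Finset.sum_eq_single j]
      · simp
      · intro i _ hij
        simp [pderiv_X_of_ne hij.symm]
      · simp
    conv_lhs => rw [this]
    rw [hsum]
    exact Finset.sum_congr rfl fun i _ => by simp [mul_comm]
  rw [key]
  apply IsWeightedHomogeneous.sum
  intro i _
  have := (hf.pderiv (n' := a - wt n i) (i := i) (by simp)).mul (hE i)
  rwa [show a - wt n i + (wt n i + δ) = a + δ by abel] at this

lemma D_mem {n k : ℕ} {m : ℤ} {f : MvPolynomial (Fin (n + 1)) ℂ} (hf : f ∈ V n k m) :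
    D n f ∈ V n k (m - 1) := by
  have := deriv_hom (D n) (0, -1) _ ?_ f (mem_V.1 hf)
  · rw [mem_V]; simpa [sub_eq_add_neg] using this
  · intro i
    rw [D, mkDerivation_X]
    rcases Nat.eq_zero_or_pos (i : ℕ) with h | h
    · rw [h]; simpa using isWeightedHomogeneous_zero _ _ _
    · have h2 := (weightedHomogeneousSubmodule ℂ (wt n) _).smul_mem ((i : ℕ) : ℂ)
        (y_hom n (i - 1))
      have h3 : wt n i + (0, -1) = ((1, ((i - 1 : ℕ) : ℤ)) : ℤ × ℤ) := by
        simp only [wt, Prod.mk_add_mk, Prod.mk.injEq]; omega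
      rw [h3]; exact h2

lemma U_mem {n k : ℕ} {m : ℤ} {f : MvPolynomial (Fin (n + 1)) ℂ} (hf : f ∈ V n k m) :
    U n f ∈ V n k (m + 1) := by
  have := deriv_hom (U n) (0, 1) _ ?_ f (mem_V.1 hf)
  · rw [mem_V]; simpa using this
  · intro i
    rw [U, mkDerivation_X]
    have h2 := (weightedHomogeneousSubmodule ℂ (wt n) _).smul_mem ((n : ℂ) - ((i : ℕ) : ℂ))
        (y_hom n (i + 1))
    have h3 : wt n i + (0, 1) = ((1, ((i + 1 : ℕ) : ℤ)) : ℤ × ℤ) := by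
      simp only [wt, Prod.mk_add_mk, Prod.mk.injEq]; omega
    rw [h3]; exact h2

lemma V_neg {n k : ℕ} {m : ℤ} (hm : m < 0) : V n k m = ⊥ := by
  rw [← Submodule.finrank_eq_zero (R := ℂ), (V_finrank n k m).2, g_neg _ _ _ hm]

lemma comm_X (n : ℕ) (i : Fin (n + 1)) :
    ⁅D n, U n⁆ (X i) = ((n : ℂ) - 2 * ((i : ℕ) : ℂ)) • (X i : MvPolynomial (Fin (n + 1)) ℂ) := by
  rw [Derivation.commutator_apply, ← y_fin]
  obtain ⟨i, hi⟩ := i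
  simp only
  rw [U_y _ _ (by omega), D_y _ _ (by omega), Derivation.map_smul, Derivation.map_smul]
  have h1 : ((n : ℂ) - i) • D n (y n (i + 1)) = (((n : ℂ) - i) * (i + 1)) • y n i := by
    rcases Nat.lt_or_ge i n with h | h
    · rw [D_y _ _ (by omega), smul_smul]; simp
    · obtain rfl : i = n := by omega
      simp
  have h2 : (i : ℂ) • U n (y n (i - 1)) = ((i : ℂ) * (n - i + 1)) • y n i := by
    rcases i with _ | i
    · simp
    · rw [Nat.add_sub_cancel, U_y _ _ (by omega), smul_smul]
      push_cast; congr 1; ring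
  rw [h1, h2, ← sub_smul]
  congr 1; ring

lemma comm_V {n k : ℕ} {m : ℤ} {f : MvPolynomial (Fin (n + 1)) ℂ} (hf : f ∈ V n k m) :
    D n (U n f) = U n (D n f) + ((n : ℂ) * k - 2 * m) • f := by
  have hH : ⁅D n, U n⁆ = mkDerivation ℂ fun i : Fin (n + 1) => ((n : ℂ) - 2 * ((i : ℕ) : ℂ)) •
      (X i : MvPolynomial (Fin (n + 1)) ℂ) := by
    apply derivation_ext; intro i; rw [comm_X, mkDerivation_X]
  have : ⁅D n, U n⁆ f = ((n : ℂ) * k - 2 * m) • f := by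
    rw [hH]
    induction hf using IsWeightedHomogeneous.induction_on with
    | zero => simp
    | add p q hp hq h1 h2 => rw [map_add, h1, h2, smul_add]
    | monomial d r hd =>
      rw [mkDerivation_monomial]
      have h1 : ∀ i ∈ d.support, (monomial (d - Finsupp.single i 1) (d i : ℂ)) •
          (((n : ℂ) - 2 * ((i : ℕ) : ℂ)) • (X i : MvPolynomial (Fin (n + 1)) ℂ)) =
          ((d i : ℂ) * ((n : ℂ) - 2 * ((i : ℕ) : ℂ))) • monomial d 1 := by
        intro i hi
        have hle : Finsupp.single i 1 ≤ d := by
          rw [Finsupp.single_le_iff]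
          exact Nat.one_le_iff_ne_zero.2 (Finsupp.mem_support_iff.1 hi)
        rw [X, smul_monomial, smul_eq_mul, monomial_mul, tsub_add_cancel_of_le hle, smul_monomial]
        simp
      rw [Finsupp.sum, Finset.sum_congr rfl h1, ← Finset.sum_smul, smul_smul, smul_monomial,
        smul_monomial]
      congr 1
      rw [Finsupp.weight_apply, Finsupp.sum] at hd
      have e1 := congrArg Prod.fst hd
      have e2 := congrArg Prod.snd hd
      simp only [Prod.fst_sum, Prod.snd_sum, wt, Prod.smul_fst, Prod.smul_snd] at e1 e2
      simp only [nsmul_eq_mul, mul_one] at e1 e2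
      have e1' : ∑ i ∈ d.support, (d i : ℂ) = k := by exact_mod_cast congrArg (Int.cast (R := ℂ)) e1
      have e2' : ∑ i ∈ d.support, (d i : ℂ) * ((i : ℕ) : ℂ) = m := by
        exact_mod_cast congrArg (Int.cast (R := ℂ)) e2
      have : ∑ i ∈ d.support, (d i : ℂ) * ((n : ℂ) - 2 * ((i : ℕ) : ℂ)) = n * k - 2 * m := by
        rw [← e1', ← e2', Finset.mul_sum, Finset.mul_sum, ← Finset.sum_sub_distrib]
        exact Finset.sum_congr rfl fun i _ => by ring
      rw [this]; simp [mul_comm]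
  rw [← this, Derivation.commutator_apply]; abel

lemma U_iter_mem {n k : ℕ} {m : ℤ} {f : MvPolynomial (Fin (n + 1)) ℂ} (hf : f ∈ V n k m) (s : ℕ) :
    (U n)^[s] f ∈ V n k (m + s) := by
  induction s with
  | zero => simpa using hf
  | succ s ih =>
    rw [Function.iterate_succ_apply']
    have := U_mem ih
    rwa [show m + (s : ℤ) + 1 = m + ((s + 1 : ℕ) : ℤ) by push_cast; ring] at this

lemma comm_iter {n k : ℕ} {m : ℤ} {f : MvPolynomial (Fin (n + 1)) ℂ} (hf : f ∈ V n k m) (s : ℕ) :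
    D n ((U n)^[s + 1] f) = (U n)^[s + 1] (D n f) +
      (((s : ℂ) + 1) * ((n : ℂ) * k - 2 * m - s)) • (U n)^[s] f := by
  induction s with
  | zero => simpa using comm_V hf
  | succ s ih =>
    rw [Function.iterate_succ_apply' (U n) (s + 1) f, comm_V (U_iter_mem hf (s + 1)), ih, map_add,
      Derivation.map_smul, ← Function.iterate_succ_apply' (U n), ← Function.iterate_succ_apply' (U n),
      add_assoc, ← add_smul]
    congr 2
    push_cast; ring

lemma surj_aux {n k : ℕ} (a : ℕ) : ∀ (s : ℕ) (m : ℤ) (f : MvPolynomial (Fin (n + 1)) ℂ),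
    f ∈ V n k m → (D n)^[a] f = 0 → (s : ℤ) < n * k - 2 * m →
    ∃ u ∈ V n k (m + s + 1), D n u = (U n)^[s] f := by
  induction a with
  | zero =>
    intro s m f hf h0 hs
    refine ⟨0, Submodule.zero_mem _, ?_⟩
    rw [Function.iterate_zero_apply] at h0
    rw [h0, map_zero]
    have : ∀ s, (U n)^[s] (0 : MvPolynomial (Fin (n + 1)) ℂ) = 0 := by
      intro s
      induction s with
      | zero => rfl
      | succ s ih => rw [Function.iterate_succ_apply', ih, map_zero]
    exact (this s).symm
  | succ a ih =>
    intro s m f hf h0 hs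
    obtain ⟨u, hu, hDu⟩ := ih (s + 1) (m - 1) (D n f) (D_mem hf) h0 (by push_cast; linarith)
    rw [show m - 1 + ((s + 1 : ℕ) : ℤ) + 1 = m + s + 1 by push_cast; ring] at hu
    have hc := comm_iter hf s
    set c : ℂ := ((s : ℂ) + 1) * ((n : ℂ) * k - 2 * m - s) with hcdef
    have hc0 : c ≠ 0 := by
      have h1 : ((s : ℂ) + 1) ≠ 0 := by exact_mod_cast Nat.succ_ne_zero s
      have h2 : ((n : ℂ) * k - 2 * m - s) ≠ 0 := by
        have : (n : ℤ) * k - 2 * m - s ≠ 0 := by omega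
        exact_mod_cast this
      exact mul_ne_zero h1 h2
    refine ⟨c⁻¹ • ((U n)^[s + 1] f - u), Submodule.smul_mem _ _ (Submodule.sub_mem _ ?_ hu), ?_⟩
    · have := U_iter_mem hf (s + 1)
      rwa [show m + ((s + 1 : ℕ) : ℤ) = m + s + 1 by push_cast; ring] at this
    · rw [Derivation.map_smul, map_sub, hc, hDu, add_sub_cancel_left, smul_smul,
        inv_mul_cancel₀ hc0, one_smul]

lemma D_iter_mem {n k : ℕ} {m : ℤ} {f : MvPolynomial (Fin (n + 1)) ℂ} (hf : f ∈ V n k m) (s : ℕ) :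
    (D n)^[s] f ∈ V n k (m - s) := by
  induction s with
  | zero => simpa using hf
  | succ s ih =>
    rw [Function.iterate_succ_apply']
    have := D_mem ih
    rwa [show m - (s : ℤ) - 1 = m - ((s + 1 : ℕ) : ℤ) by push_cast; ring] at this

lemma D_surj {n k : ℕ} {m : ℤ} (hm : 2 * m ≤ n * k) :
    (V n k m).map (D n : MvPolynomial (Fin (n + 1)) ℂ →ₗ[ℂ] MvPolynomial (Fin (n + 1)) ℂ) =
      V n k (m - 1) := by
  apply le_antisymm
  · rintro _ ⟨f, hf, rfl⟩
    exact D_mem hf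
  · intro f hf
    have h0 : (D n)^[m.toNat] f = 0 := by
      have := D_iter_mem hf m.toNat
      rw [V_neg (by omega)] at this
      exact this
    obtain ⟨u, hu, h⟩ := surj_aux _ 0 _ f hf h0 (by push_cast; linarith)
    refine ⟨u, ?_, h⟩
    simpa using hu

/-- Semi-invariants of degree `k` and weight `m`. -/
noncomputable def S (n k : ℕ) (m : ℤ) : Submodule ℂ (MvPolynomial (Fin (n + 1)) ℂ) :=
  V n k m ⊓ LinearMap.ker
    (D n : MvPolynomial (Fin (n + 1)) ℂ →ₗ[ℂ] MvPolynomial (Fin (n + 1)) ℂ)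

instance (n k : ℕ) (m : ℤ) : FiniteDimensional ℂ (S n k m) :=
  Submodule.finiteDimensional_of_le inf_le_left

lemma S_mul {n k l : ℕ} {m m' : ℤ} : ∀ a ∈ S n k m, ∀ b ∈ S n l m', a * b ∈ S n (k + l) (m + m') := by
  rintro a ⟨h1, h2⟩ b ⟨h3, h4⟩
  refine ⟨?_, ?_⟩
  · have := (mem_V.1 h1).mul (mem_V.1 h3)
    exact mem_V.2 (by simpa using this)
  · have h2' : D n a = 0 := h2
    have h4' : D n b = 0 := h4
    change D n (a * b) = 0
    rw [Derivation.leibniz, h2', h4']; simp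

lemma S_rank (n k : ℕ) (m : ℤ) :
    Module.finrank ℂ ((V n k m).map
      (D n : MvPolynomial (Fin (n + 1)) ℂ →ₗ[ℂ] MvPolynomial (Fin (n + 1)) ℂ)) +
      Module.finrank ℂ (S n k m) = g k n m := by
  have h := LinearMap.finrank_range_add_finrank_ker (LinearMap.domRestrict
    (D n : MvPolynomial (Fin (n + 1)) ℂ →ₗ[ℂ] MvPolynomial (Fin (n + 1)) ℂ) (V n k m))
  rw [LinearMap.range_domRestrict, LinearMap.ker_domRestrict, (V_finrank n k m).2,
    ← Submodule.finrank_map_subtype_eq, Submodule.map_comap_subtype] at h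
  exact h

lemma S_ge (n k : ℕ) (m : ℤ) : g k n m ≤ g k n (m - 1) + Module.finrank ℂ (S n k m) := by
  rw [← S_rank, ← (V_finrank n k (m - 1)).2]
  gcongr
  apply Submodule.finrank_mono
  rintro _ ⟨f, hf, rfl⟩
  exact D_mem hf

lemma S_eq {n k : ℕ} {m : ℤ} (hm : 2 * m ≤ n * k) :
    g k n m = g k n (m - 1) + Module.finrank ℂ (S n k m) := by
  rw [← S_rank, ← (V_finrank n k (m - 1)).2, D_surj hm]

lemma S_zero (n k : ℕ) : 1 ≤ Module.finrank ℂ (S n k 0) := by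
  have := S_ge n k 0
  rw [g_at_zero, g_neg _ _ _ (by norm_num)] at this
  omega

/-! ### The induction -/

lemma P_S {n k : ℕ} (h : P n k) (m : ℕ) (h1 : m ≠ 1) (hm : 2 * m ≤ n * k) :
    1 ≤ Module.finrank ℂ (S n k m) := by
  rcases Nat.eq_zero_or_pos m with rfl | h0
  · exact S_zero n k
  · have := h.1 m (by omega) hm
    have := S_ge n k m
    omega

lemma P_step {n k l : ℕ} (hk : P n k) (hl : P n l) (hnl : 4 ≤ n * l) (hnk : 6 ≤ n * k)
    (hev : Even (n * l)) : P n (k + l) := by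
  have hmul : n * (k + l) = n * k + n * l := by ring
  obtain ⟨c, hc⟩ := hev
  constructor
  · intro m h2 hm
    rw [hmul] at hm
    suffices h : 1 ≤ Module.finrank ℂ (S n (k + l) m) by
      have := S_eq (n := n) (k := k + l) (m := m) (by exact_mod_cast hmul ▸ hm)
      omega
    obtain ⟨m1, m2, hm12, h11, h21, h1k, h2l⟩ : ∃ m1 m2 : ℕ, m1 + m2 = m ∧ m1 ≠ 1 ∧ m2 ≠ 1 ∧
        2 * m1 ≤ n * k ∧ 2 * m2 ≤ n * l := by
      rcases Nat.lt_or_ge (n * k) (2 * m) with h | h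
      · by_cases h' : m = n * k / 2 + 1
        · exact ⟨n * k / 2 - 1, 2, by omega, by omega, by omega, by omega, by omega⟩
        · exact ⟨n * k / 2, m - n * k / 2, by omega, by omega, by omega, by omega, by omega⟩
      · exact ⟨m, 0, by omega, by omega, by omega, by omega, by omega⟩
    have := mul_le (S n k m1) (S n l m2) (S n (k + l) (m1 + m2)) S_mul (P_S hk m1 h11 h1k)
    have h3 := P_S hl m2 h21 h2l
    rw [← hm12]; push_cast
    omega
  · intro m hm
    rw [hmul] at hm
    suffices h : 2 ≤ Module.finrank ℂ (S n (k + l) m) by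
      have := S_eq (n := n) (k := k + l) (m := m) (by exact_mod_cast hmul ▸ hm.le)
      omega
    obtain ⟨m1, rfl⟩ : ∃ m1, m = c + m1 := ⟨m - c, by omega⟩
    have := mul_le (S n l c) (S n k m1) (S n (l + k) (c + m1)) S_mul
      (P_S hl c (by omega) (by omega))
    have h2 := hk.2 m1 (by omega)
    have h3 := S_ge n k m1
    rw [add_comm k l]; push_cast
    omega

lemma P_of_base (n : ℕ) (hn : 8 ≤ n) (hb : ∀ k, 8 ≤ k → k ≤ 15 → P n k) :
    ∀ k, 8 ≤ k → P n k := by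
  intro k
  induction k using Nat.strong_induction_on with
  | _ k ih =>
    intro hk
    rcases Nat.lt_or_ge 15 k with h | h
    · obtain ⟨j, rfl⟩ : ∃ j, k = j + 8 := ⟨k - 8, by omega⟩
      exact P_step (ih j (by omega) (by omega)) (hb 8 le_rfl (by omega)) (by omega)
        (by nlinarith) ⟨n * 4, by ring⟩
    · exact hb k hk h

lemma P_all (n k : ℕ) (hn : 8 ≤ n) (hk : 8 ≤ k) : P n k :=
  P_of_base n hn (fun j h8 h15 => P_symm
    (P_of_base j h8 (fun i hi hi' => P_base j i h8 h15 hi hi') n hn)) k hk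

end GKey

/-- The key inequality for strict unimodality of $G_{n,k,r}(q)$: for $n, r ≥ 8$
with at least one of them even, $k ≥ r$ and $nr/2 ≤ m ≤ nk/2$,
$p(k,n,m) - p(k,n,m-1) > p(k-r,n,m-nr/2) - p(k-r,n,m-nr/2-1)$. -/
theorem G_strict_unimodal_key (n r k m : ℕ) (hn : 8 ≤ n) (hr : 8 ≤ r)
    (hpar : Even n ∨ Even r) (hk : r ≤ k) (hlow : n * r / 2 ≤ m)
    (hm : 2 * m ≤ n * k) :
    (pZ (k - r) n ((m : ℤ) - n * r / 2) : ℤ) -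
        pZ (k - r) n ((m : ℤ) - n * r / 2 - 1) <
      (pZ k n m : ℤ) - pZ k n ((m : ℤ) - 1) := by
  have hev : Even (n * r) := by rcases hpar with h | h <;> simp [h]
  obtain ⟨c, hc⟩ := hev
  have hcZ : (n : ℤ) * r / 2 = c := by
    have : (n : ℤ) * r = c + c := by exact_mod_cast hc
    omega
  have hc' : n * r / 2 = c := by omega
  have hc32 : 64 ≤ n * r := by nlinarith
  rw [hc'] at hlow
  rw [hcZ]
  simp only [GKey.pZ_eq]
  obtain ⟨l, rfl⟩ : ∃ l, k = r + l := ⟨k - r, by omega⟩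
  obtain ⟨m', rfl⟩ : ∃ m', m = c + m' := ⟨m - c, by omega⟩
  have e1 : r + l - r = l := by omega
  have e2 : ((c + m' : ℕ) : ℤ) - c = m' := by push_cast; ring
  rw [e1, e2]
  have hml : 2 * m' ≤ n * l := by rw [Nat.mul_add n r l] at hm; omega
  have hS1 := GKey.S_eq (n := n) (k := l) (m := m') (by exact_mod_cast hml)
  have hS2 := GKey.S_eq (n := n) (k := r + l) (m := (c + m' : ℕ)) (by exact_mod_cast hm)
  have hI := (GKey.P_all n r hn hr).2 c (by omega)
  have hI' := GKey.S_ge n r c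
  have hpos := (GKey.P_all n (r + l) hn (by omega)).1 (c + m') (by omega) hm
  rcases Nat.eq_zero_or_pos (Module.finrank ℂ (GKey.S n l m')) with h0 | h0
  · omega
  · have := GKey.mul_lt (GKey.S n r c) (GKey.S n l m') (GKey.S n (r + l) (c + m')) GKey.S_mul
      (by omega) h0
    push_cast at *
    omega
end

section
/- Let n, r ≥ 8 with at least one of n, r even, and k ≥ r. Writing G_{n,k,r}(q) = [n+k choose k]_q − q^{nr/2} [n+k−r choose k−r]_q = Σ_{m=0}^{nk} g_m q^m, we have g_0 = g_1 = 1, g_{nk−1} = g_{nk} = 1, g_m = g_{nk−m} for all m, and g_{m−1} < g_m for 2 ≤ m ≤ nk/2. -/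
open Polynomial in
/-- The Gaussian binomial coefficient $[n+k, k]_q$ as a polynomial in $q$,
via its partition generating-function description. -/
noncomputable def gauss (n k : ℕ) : Polynomial ℤ :=
  ∑ m ∈ Finset.range (n * k + 1), Polynomial.C (p k n m : ℤ) * Polynomial.X ^ m

set_option autoImplicit false

namespace GSU
open MvPolynomial

/-- bi-weight of a variable: (degree, index) -/
def wt (n : ℕ) (i : Fin (n+1)) : ℤ × ℤ := (1, (i.1 : ℤ))

/-- bihomogeneous component of degree `k` and weight `m`. -/
noncomputable def V (n : ℕ) (k m : ℤ) : Submodule ℂ (MvPolynomial (Fin (n+1)) ℂ) :=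
  weightedHomogeneousSubmodule ℂ (wt n) (k, m)

/-- lowering derivation -/
noncomputable def D (n : ℕ) : Derivation ℂ (MvPolynomial (Fin (n+1)) ℂ) (MvPolynomial (Fin (n+1)) ℂ) :=
  mkDerivation ℂ (fun i => (i.1 : ℂ) • X ⟨i.1 - 1, by omega⟩)

/-- raising derivation -/
noncomputable def F (n : ℕ) : Derivation ℂ (MvPolynomial (Fin (n+1)) ℂ) (MvPolynomial (Fin (n+1)) ℂ) :=
  mkDerivation ℂ (fun i => ((n : ℂ) - (i.1 : ℂ)) • X ⟨min (i.1 + 1) n, by omega⟩)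

lemma mkDer_mem {n : ℕ} (f : Fin (n+1) → MvPolynomial (Fin (n+1)) ℂ) (s : ℤ × ℤ)
    (hf : ∀ i, IsWeightedHomogeneous (wt n) (f i) (wt n i + s)) (d : ℤ × ℤ)
    {v : MvPolynomial (Fin (n+1)) ℂ} (hv : IsWeightedHomogeneous (wt n) v d) :
    IsWeightedHomogeneous (wt n) (mkDerivation ℂ f v) (d + s) := by
  classical
  rw [v.as_sum, map_sum]
  refine IsWeightedHomogeneous.sum _ _ _ fun e he => ?_
  have hd : Finsupp.weight (wt n) e = d := hv (by simpa using he)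
  rw [mkDerivation_monomial, Finsupp.sum]
  refine Submodule.smul_mem (weightedHomogeneousSubmodule ℂ (wt n) (d+s)) _ ?_
  refine IsWeightedHomogeneous.sum _ _ _ fun i hi => ?_
  have h1 : IsWeightedHomogeneous (wt n) (monomial (e - Finsupp.single i 1) ((e i : ℕ) : ℂ)) (d - wt n i) := by
    apply isWeightedHomogeneous_monomial
    have : e = (e - Finsupp.single i 1) + Finsupp.single i 1 := by
      ext j
      by_cases hj : j = i
      · subst hj
        have : e j ≠ 0 := by simpa using hi
        simp; omega
      · simp [Ne.symm hj]
    rw [← hd]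
    conv_rhs => rw [this]
    rw [map_add, Finsupp.weight_single]
    simp
  have := h1.mul (hf i)
  rw [smul_eq_mul]
  convert this using 1
  abel

lemma D_gen (n : ℕ) (i : Fin (n+1)) : IsWeightedHomogeneous (wt n)
    ((i.1 : ℂ) • (X ⟨i.1 - 1, by omega⟩ : MvPolynomial (Fin (n+1)) ℂ)) (wt n i + (0, -1)) := by
  by_cases hi : i.1 = 0
  · have h0 : (i.1 : ℂ) = 0 := by simp [hi]
    rw [h0, zero_smul]; exact isWeightedHomogeneous_zero _ _ _
  have h1 := isWeightedHomogeneous_X ℂ (wt n) (⟨i.1 - 1, by omega⟩ : Fin (n+1))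
  have h2 : wt n ⟨i.1 - 1, by omega⟩ = wt n i + (0, -1) := by
    ext
    · simp [wt]
    · simp only [wt, Prod.snd_add]; omega
  rw [h2] at h1
  exact Submodule.smul_mem (weightedHomogeneousSubmodule ℂ (wt n) _) _ h1

lemma F_gen (n : ℕ) (i : Fin (n+1)) : IsWeightedHomogeneous (wt n)
    (((n : ℂ) - (i.1 : ℂ)) • (X ⟨min (i.1 + 1) n, by omega⟩ : MvPolynomial (Fin (n+1)) ℂ))
      (wt n i + (0, 1)) := by
  by_cases hi : i.1 = n
  · have h0 : (n : ℂ) - (i.1 : ℂ) = 0 := by simp [hi]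
    rw [h0, zero_smul]; exact isWeightedHomogeneous_zero _ _ _
  have h1 := isWeightedHomogeneous_X ℂ (wt n) (⟨min (i.1 + 1) n, by omega⟩ : Fin (n+1))
  have h2 : wt n ⟨min (i.1 + 1) n, by omega⟩ = wt n i + (0, 1) := by
    ext
    · simp [wt]
    · simp only [wt, Prod.snd_add]; omega
  rw [h2] at h1
  exact Submodule.smul_mem (weightedHomogeneousSubmodule ℂ (wt n) _) _ h1

lemma D_mem {n : ℕ} {k m : ℤ} {v : MvPolynomial (Fin (n+1)) ℂ} (hv : v ∈ V n k m) :
    D n v ∈ V n k (m - 1) := by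
  have := mkDer_mem _ (0, -1) (D_gen n) _ hv
  rw [Prod.mk_add_mk, add_zero, ← sub_eq_add_neg] at this
  exact this

lemma F_mem {n : ℕ} {k m : ℤ} {v : MvPolynomial (Fin (n+1)) ℂ} (hv : v ∈ V n k m) :
    F n v ∈ V n k (m + 1) := by
  have := mkDer_mem _ (0, 1) (F_gen n) _ hv
  rw [Prod.mk_add_mk, add_zero] at this
  exact this

lemma lie_DF (n : ℕ) : ⁅D n, F n⁆ = mkDerivation ℂ (fun i => ((n : ℂ) - 2 * (i.1 : ℂ)) • X i) := by
  apply derivation_ext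
  intro i
  rw [Derivation.commutator_apply, mkDerivation_X]
  simp only [F, D, mkDerivation_X, Derivation.map_smul]
  rw [smul_smul, smul_smul]
  have h1 : ((n : ℂ) - (i.1 : ℂ)) * ((min (i.1+1) n : ℕ) : ℂ) = ((n : ℂ) - (i.1 : ℂ)) * ((i.1 : ℂ) + 1) := by
    by_cases hi : i.1 = n
    · simp [hi]
    · rw [min_eq_left (by omega)]; push_cast; rfl
  have h2 : (i.1 : ℂ) * ((n : ℂ) - ((i.1 - 1 : ℕ) : ℂ)) = (i.1 : ℂ) * ((n : ℂ) - (i.1 : ℂ) + 1) := by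
    by_cases hi : i.1 = 0
    · simp [hi]
    · rw [Nat.cast_sub (by omega)]; push_cast; ring
  have h3 : (((n : ℂ) - (i.1 : ℂ)) * ((i.1 : ℂ) + 1)) • (X ⟨min (i.1+1) n - 1, by omega⟩ : MvPolynomial (Fin (n+1)) ℂ)
      = (((n : ℂ) - (i.1 : ℂ)) * ((i.1 : ℂ) + 1)) • X i := by
    by_cases hi : i.1 = n
    · simp [hi]
    · congr 2; ext; simp; omega
  have h4 : ((i.1 : ℂ) * ((n : ℂ) - (i.1 : ℂ) + 1)) • (X ⟨min (i.1 - 1 + 1) n, by omega⟩ : MvPolynomial (Fin (n+1)) ℂ)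
      = ((i.1 : ℂ) * ((n : ℂ) - (i.1 : ℂ) + 1)) • X i := by
    by_cases hi : i.1 = 0
    · simp [hi]
    · congr 2; ext; simp; omega
  simp only [h1, h2, h3, h4, ← sub_smul]
  congr 1; ring

lemma weight_eq (n : ℕ) (e : Fin (n+1) →₀ ℕ) :
    Finsupp.weight (wt n) e = (((∑ i, e i : ℕ) : ℤ), ((∑ i, i.1 * e i : ℕ) : ℤ)) := by
  rw [Finsupp.weight_apply, Finsupp.sum_fintype _ _ (by simp)]
  ext
  · simp [Prod.fst_sum, wt]
  · simp [Prod.snd_sum, wt, mul_comm]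

lemma comm_DF {n : ℕ} {k m : ℤ} {v : MvPolynomial (Fin (n+1)) ℂ} (hv : v ∈ V n k m) :
    D n (F n v) = F n (D n v) + ((n * k - 2 * m : ℤ) : ℂ) • v := by
  classical
  rw [← sub_eq_iff_eq_add', ← Derivation.commutator_apply, lie_DF]
  conv_lhs => rw [v.as_sum]
  conv_rhs => rw [v.as_sum]
  rw [map_sum, Finset.smul_sum]
  refine Finset.sum_congr rfl fun e he => ?_
  have hd : Finsupp.weight (wt n) e = (k, m) := hv (by simpa using he)
  rw [weight_eq, Prod.mk.injEq] at hd
  rw [mkDerivation_monomial, Finsupp.sum_fintype _ _ (by simp)]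
  have : ∀ i : Fin (n+1), monomial (e - Finsupp.single i 1) ((e i : ℕ) : ℂ) • (((n : ℂ) - 2 * (i.1 : ℂ)) • (X i : MvPolynomial (Fin (n+1)) ℂ))
      = monomial e ((e i : ℂ) * ((n : ℂ) - 2 * (i.1 : ℂ))) := by
    intro i
    by_cases hi : e i = 0
    · simp [hi]
    · rw [smul_eq_mul, mul_smul_comm, X, monomial_mul, smul_monomial]
      have h5 : (e - Finsupp.single i 1) + Finsupp.single i 1 = e := by
        ext j
        by_cases hj : j = i
        · subst hj
          simp; omega
        · simp [Ne.symm hj]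
      rw [h5]
      congr 1
      simp [mul_comm]
  simp only [this]
  rw [← map_sum, smul_monomial, smul_monomial]
  congr 1
  rw [smul_eq_mul, smul_eq_mul, mul_comm]
  congr 1
  rw [← hd.1, ← hd.2]
  push_cast
  rw [Finset.mul_sum, Finset.mul_sum, ← Finset.sum_sub_distrib]
  refine Finset.sum_congr rfl fun i _ => ?_
  ring

lemma iter_D_mem {n : ℕ} {k m : ℤ} {v : MvPolynomial (Fin (n+1)) ℂ} (hv : v ∈ V n k m) (s : ℕ) :
    (D n)^[s] v ∈ V n k (m - s) := by
  induction s with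
  | zero => simpa using hv
  | succ s ih =>
    rw [Function.iterate_succ_apply']
    have := D_mem ih
    convert this using 1
    push_cast; ring

lemma iter_D_F {n : ℕ} {k m : ℤ} {v : MvPolynomial (Fin (n+1)) ℂ} (hv : v ∈ V n k m) (s : ℕ) :
    (D n)^[s+1] (F n v) = F n ((D n)^[s+1] v) +
      ((s + 1 : ℂ) * ((n * k - 2 * m : ℤ) + s : ℂ)) • (D n)^[s] v := by
  induction s with
  | zero => simpa using comm_DF hv
  | succ s ih =>
    rw [Function.iterate_succ_apply' (D n) (s+1), ih, map_add, Derivation.map_smul,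
      comm_DF (iter_D_mem hv (s+1)), ← Function.iterate_succ_apply' (D n) s,
      ← Function.iterate_succ_apply' (D n) (s+1), add_assoc, ← add_smul]
    congr 2
    push_cast; ring

lemma iter_D_lin {n : ℕ} (s : ℕ) (u v : MvPolynomial (Fin (n+1)) ℂ) (c : ℂ) :
    (D n)^[s] (u - c • v) = (D n)^[s] u - c • (D n)^[s] v := by
  induction s with
  | zero => rfl
  | succ s ih => simp only [Function.iterate_succ_apply', ih, map_sub, Derivation.map_smul]

lemma surj_aux {n : ℕ} {k m : ℤ} (h : 0 < n * k - 2 * m) (s : ℕ) :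
    ∀ v ∈ V n k m, (D n)^[s] v = 0 → ∃ u ∈ V n k (m+1), D n u = v := by
  induction s with
  | zero => intro v hv h0; exact ⟨0, Submodule.zero_mem _, by simpa using h0.symm⟩
  | succ s ih =>
    intro v hv h0
    set c : ℂ := ((s + 1 : ℂ) * ((n * k - 2 * m : ℤ) + s : ℂ)) with hc
    have hc0 : c ≠ 0 := by
      have : (0 : ℤ) < (s + 1) * ((n * k - 2 * m) + s) := by positivity
      have h2 : c = (((s + 1) * ((n * k - 2 * m) + s) : ℤ) : ℂ) := by rw [hc]; push_cast; ring
      rw [h2]; exact_mod_cast this.ne'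
    have hF := F_mem hv
    have hDF : D n (F n v) ∈ V n k m := by simpa using D_mem hF
    obtain ⟨u, hu, hu2⟩ := ih (D n (F n v) - c • v)
      (Submodule.sub_mem _ hDF (Submodule.smul_mem _ _ hv)) (by
        rw [iter_D_lin, ← Function.iterate_succ_apply, iter_D_F hv, h0, map_zero, zero_add, sub_self])
    refine ⟨c⁻¹ • (F n v - u), Submodule.smul_mem _ _ (Submodule.sub_mem _ hF hu), ?_⟩
    rw [Derivation.map_smul, map_sub, hu2, sub_sub_cancel, smul_smul, inv_mul_cancel₀ hc0, one_smul]

lemma V_neg {n : ℕ} {k m : ℤ} (hm : m < 0) {v : MvPolynomial (Fin (n+1)) ℂ} (hv : v ∈ V n k m) : v = 0 := by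
  by_contra h
  obtain ⟨e, he⟩ := exists_coeff_ne_zero h
  have := hv he
  rw [weight_eq, Prod.mk.injEq] at this
  omega

lemma surj {n : ℕ} {k m : ℤ} (h : 0 < n * k - 2 * m) (v) (hv : v ∈ V n k m) :
    ∃ u ∈ V n k (m+1), D n u = v := by
  refine surj_aux h (m.toNat + 1) v hv ?_
  exact V_neg (by push_cast; omega) (iter_D_mem hv _)

/-- exponent vectors of degree `k` and weight `m` -/
def S (n k : ℕ) (m : ℤ) : Finset (Fin (n+1) → ℕ) :=
  (Finset.Nat.antidiagonalTuple (n+1) k).filter (fun e => ((∑ i, i.1 * e i : ℕ) : ℤ) = m)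

/-- coefficient of the Gaussian binomial -/
def a (n k : ℕ) (m : ℤ) : ℕ := (S n k m).card

lemma mem_S {n k : ℕ} {m : ℤ} {e : Fin (n+1) → ℕ} :
    e ∈ S n k m ↔ ∑ i, e i = k ∧ ((∑ i, i.1 * e i : ℕ) : ℤ) = m := by
  simp [S, Finset.Nat.mem_antidiagonalTuple]

/-- indexing equivalence -/
noncomputable def eqS (n k : ℕ) (m : ℤ) :
    {d : Fin (n+1) →₀ ℕ | Finsupp.weight (wt n) d = ((k : ℤ), m)} ≃ S n k m :=
  Equiv.subtypeEquiv Finsupp.equivFunOnFinite (by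
    intro e
    simp only [Set.mem_ofPred_eq, weight_eq, Prod.mk.injEq, mem_S, Finsupp.equivFunOnFinite_apply]
    norm_cast)

noncomputable def basisV (n k : ℕ) (m : ℤ) : Module.Basis (S n k m) ℂ (V n k m) :=
  ((basisRestrictSupport ℂ {d : Fin (n+1) →₀ ℕ | Finsupp.weight (wt n) d = ((k : ℤ), m)}).reindex
    (eqS n k m)).map (LinearEquiv.ofEq _ _ (by
      rw [V, weightedHomogeneousSubmodule_eq_finsupp_supported]; rfl))

instance (n k : ℕ) (m : ℤ) : Module.Finite ℂ (V n k m) := Module.Finite.of_basis (basisV n k m)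

lemma finrank_V (n k : ℕ) (m : ℤ) : Module.finrank ℂ (V n k m) = a n k m := by
  rw [Module.finrank_eq_card_basis (basisV n k m)]; simp [a]

/-- covariants -/
noncomputable def Cv (n k : ℕ) (m : ℤ) : Submodule ℂ (MvPolynomial (Fin (n+1)) ℂ) :=
  V n k m ⊓ LinearMap.ker (D n).toLinearMap

noncomputable def c (n k : ℕ) (m : ℤ) : ℕ := Module.finrank ℂ (Cv n k m)

lemma mem_Cv {n k : ℕ} {m : ℤ} {v} : v ∈ Cv n k m ↔ v ∈ V n k m ∧ D n v = 0 := by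
  simp [Cv, Submodule.mem_inf]

instance (n k : ℕ) (m : ℤ) : Module.Finite ℂ (Cv n k m) :=
  Submodule.finiteDimensional_inf_left _ _

lemma a_eq {n k : ℕ} {m : ℤ} (h : 2 * (m - 1) < n * k) : a n k m = a n k (m-1) + c n k m := by
  let f : V n k m →ₗ[ℂ] V n k (m-1) := LinearMap.restrict (D n).toLinearMap (fun v hv => D_mem hv)
  have hs : Function.Surjective f := by
    rintro ⟨v, hv⟩
    obtain ⟨u, hu, hu2⟩ := surj (by linarith) v hv
    rw [sub_add_cancel] at hu
    exact ⟨⟨u, hu⟩, Subtype.ext hu2⟩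
  have h1 := LinearMap.finrank_range_add_finrank_ker f
  rw [LinearMap.range_eq_top.2 hs, finrank_top, finrank_V, finrank_V] at h1
  have h2 : (LinearMap.ker f).map (V n k m).subtype = Cv n k m := by
    ext v
    rw [mem_Cv, Submodule.mem_map]
    constructor
    · rintro ⟨⟨w, hw⟩, hw2, rfl⟩
      exact ⟨hw, congrArg Subtype.val (LinearMap.mem_ker.1 hw2)⟩
    · rintro ⟨hv, hv2⟩
      exact ⟨⟨v, hv⟩, LinearMap.mem_ker.2 (Subtype.ext hv2), rfl⟩
  have h3 := (Submodule.equivSubtypeMap (V n k m) (LinearMap.ker f)).finrank_eq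
  rw [h2] at h3
  rw [c, ← h3, h1]

lemma mul_mem_Cv {n k₁ k₂ : ℕ} {m₁ m₂ : ℤ} {u v} (hu : u ∈ Cv n k₁ m₁) (hv : v ∈ Cv n k₂ m₂) :
    u * v ∈ Cv n (k₁ + k₂) (m₁ + m₂) := by
  rw [mem_Cv] at *
  refine ⟨?_, ?_⟩
  · have := IsWeightedHomogeneous.mul hu.1 hv.1
    rw [Prod.mk_add_mk] at this
    rw [V, Nat.cast_add]
    exact this
  · rw [Derivation.leibniz, hu.2, hv.2, smul_zero, smul_zero, add_zero]

/-- multiplication by a covariant -/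
noncomputable def mulMap {n k₁ k₂ : ℕ} {m₁ m₂ : ℤ} {u : MvPolynomial (Fin (n+1)) ℂ}
    (hu : u ∈ Cv n k₁ m₁) :
    Cv n k₂ m₂ →ₗ[ℂ] Cv n (k₁ + k₂) (m₁ + m₂) :=
  LinearMap.restrict (LinearMap.mulLeft ℂ u) (fun _ hv => mul_mem_Cv hu hv)

lemma mulMap_inj {n k₁ k₂ : ℕ} {m₁ m₂ : ℤ} {u : MvPolynomial (Fin (n+1)) ℂ}
    (hu : u ∈ Cv n k₁ m₁) (h0 : u ≠ 0) :
    Function.Injective (mulMap (k₂ := k₂) (m₂ := m₂) hu) := by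
  intro x y hxy
  exact Subtype.ext (mul_left_cancel₀ h0 (congrArg Subtype.val hxy))

lemma exists_ne {n k : ℕ} {m : ℤ} (h : 0 < c n k m) : ∃ u ∈ Cv n k m, u ≠ 0 := by
  have := Module.finrank_pos_iff_exists_ne_zero.1 h
  obtain ⟨⟨u, hu⟩, h0⟩ := this
  exact ⟨u, hu, fun h => h0 (Subtype.ext h)⟩

lemma c_le {n k₁ k₂ : ℕ} {m₁ m₂ : ℤ} (h : 0 < c n k₁ m₁) :
    c n k₂ m₂ ≤ c n (k₁ + k₂) (m₁ + m₂) := by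
  obtain ⟨u, hu, h0⟩ := exists_ne h
  exact LinearMap.finrank_le_finrank_of_injective (mulMap_inj hu h0)

lemma c_lt {n k₁ k₂ : ℕ} {m₁ m₂ : ℤ} (h : 2 ≤ c n k₁ m₁) (h2 : 0 < c n k₂ m₂) :
    c n k₂ m₂ < c n (k₁ + k₂) (m₁ + m₂) := by
  obtain ⟨u, hu, h0⟩ := exists_ne (show 0 < c n k₁ m₁ by omega)
  refine lt_of_le_of_ne (c_le (by omega)) fun heq => ?_
  have hin := mulMap_inj (k₂ := k₂) (m₂ := m₂) hu h0
  let E := LinearEquiv.ofInjectiveOfFinrankEq (mulMap (k₂ := k₂) (m₂ := m₂) hu) hin heq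
  have hall : ∀ v : Cv n k₁ m₁, ∃ r : ℂ, r • (⟨u, hu⟩ : Cv n k₁ m₁) = v := by
    rintro ⟨v, hv⟩
    let T : Module.End ℂ (Cv n k₂ m₂) := E.symm.toLinearMap ∘ₗ (mulMap hv)
    have : Nontrivial (Cv n k₂ m₂) := Module.finrank_pos_iff.1 h2
    obtain ⟨μ, hμ⟩ := Module.End.exists_eigenvalue T
    obtain ⟨w, hw⟩ := hμ.exists_hasEigenvector
    have h3 := hw.apply_eq_smul
    have h4 : mulMap hv w = E (μ • w) := by rw [← h3]; simp [T]
    have h5 : v * w.1 = u * (μ • w.1) := congrArg Subtype.val h4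
    refine ⟨μ, Subtype.ext ?_⟩
    have hw0 : w.1 ≠ 0 := fun h => hw.2 (Subtype.ext h)
    apply mul_right_cancel₀ hw0
    change (μ • u) * w.1 = v * w.1
    rw [h5, smul_mul_assoc, mul_smul_comm]
  have := finrank_le_one _ hall
  change c n k₁ m₁ ≤ 1 at this
  omega

lemma a_neg {n k : ℕ} {m : ℤ} (hm : m < 0) : a n k m = 0 := by
  rw [a, Finset.card_eq_zero, Finset.eq_empty_iff_forall_notMem]
  intro e he
  have := (mem_S.1 he).2
  omega

lemma a_zero_right (n : ℕ) (m : ℤ) : a n 0 m = if m = 0 then 1 else 0 := by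
  have h : ∀ e, e ∈ S n 0 m ↔ e = 0 ∧ m = 0 := by
    intro e
    rw [mem_S]
    constructor
    · rintro ⟨h1, h2⟩
      have h0 : e = 0 := by
        funext i
        exact (Finset.sum_eq_zero_iff.1 h1) i (Finset.mem_univ _)
      subst h0
      simp at h2
      exact ⟨rfl, h2.symm⟩
    · rintro ⟨rfl, rfl⟩
      simp
  split_ifs with hm
  · rw [a, Finset.card_eq_one]
    exact ⟨0, by ext e; rw [h]; simp [hm]⟩
  · rw [a, Finset.card_eq_zero, Finset.eq_empty_iff_forall_notMem]
    intro e he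
    exact hm ((h e).1 he).2

lemma a_zero_left (k : ℕ) (m : ℤ) : a 0 k m = if m = 0 then 1 else 0 := by
  have h : ∀ e, e ∈ S 0 k m ↔ e = (fun _ => k) ∧ m = 0 := by
    intro e
    rw [mem_S]
    simp only [Fin.sum_univ_succ, Fin.sum_univ_zero, Fin.val_zero, funext_iff]
    simp [eq_comm]
  split_ifs with hm
  · rw [a, Finset.card_eq_one]
    exact ⟨fun _ => k, by ext e; rw [h]; simp [hm]⟩
  · rw [a, Finset.card_eq_zero, Finset.eq_empty_iff_forall_notMem]
    intro e he
    exact hm ((h e).1 he).2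

lemma a_rev (n k : ℕ) (m : ℤ) : a n k m = a n k (n * k - m) := by
  have key : ∀ m : ℤ, ∀ e ∈ S n k m, e ∘ Fin.rev ∈ S n k (n * k - m) := by
    intro m e he
    rw [mem_S] at he ⊢
    obtain ⟨h1, h2⟩ := he
    constructor
    · rw [← h1]
      exact Equiv.sum_comp Fin.revPerm e
    · rw [← Equiv.sum_comp Fin.revPerm (fun i => i.1 * (e ∘ Fin.rev) i)]
      rw [← h1, ← h2]
      push_cast
      rw [Finset.mul_sum, ← Finset.sum_sub_distrib]
      refine Finset.sum_congr rfl fun i _ => ?_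
      simp only [Fin.revPerm_apply, Function.comp, Fin.rev_rev, Fin.val_rev]
      rw [Nat.cast_sub (by omega)]
      push_cast; ring
  refine Finset.card_bij' (fun e _ => e ∘ Fin.rev) (fun e _ => e ∘ Fin.rev) (key m) ?_ ?_ ?_
  · intro e he
    have := key _ e he
    rwa [sub_sub_cancel] at this
  · intro e _; funext i; simp
  · intro e _; funext i; simp

lemma cons_mem_S {n k : ℕ} {m : ℤ} {x : ℕ} {f : Fin (n+1) → ℕ} :
    (Fin.cons x f : Fin (n+2) → ℕ) ∈ S (n+1) k m ↔
      x + ∑ i, f i = k ∧ ((∑ i, i.1 * f i : ℕ) : ℤ) + ((∑ i, f i : ℕ) : ℤ) = m := by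
  rw [mem_S, Fin.sum_univ_succ, Fin.sum_univ_succ (fun i : Fin (n+2) => i.1 * _)]
  simp only [Fin.cons_zero, Fin.cons_succ, Fin.val_zero, Fin.val_succ, zero_mul, zero_add, add_mul,
    Finset.sum_add_distrib, one_mul, Nat.cast_add]

lemma a_rec (n k : ℕ) (m : ℤ) :
    a (n+1) (k+1) m = a (n+1) k m + a n (k+1) (m - (k+1)) := by
  classical
  have h1 : S (n+1) (k+1) m = (S (n+1) k m).image (fun e => Fin.cons (e 0 + 1) (Fin.tail e)) ∪
      (S n (k+1) (m - (k+1))).image (fun e => (Fin.cons 0 e : Fin (n+2) → ℕ)) := by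
    ext e
    obtain ⟨x, f, rfl⟩ : ∃ (x : ℕ) (f : Fin (n+1) → ℕ), e = Fin.cons x f :=
      ⟨e 0, Fin.tail e, (Fin.cons_self_tail e).symm⟩
    simp only [Finset.mem_union, Finset.mem_image, cons_mem_S]
    constructor
    · rintro ⟨h1, h2⟩
      rcases x with _ | x
      · right
        refine ⟨f, mem_S.2 ⟨by omega, by omega⟩, rfl⟩
      · left
        exact ⟨Fin.cons x f, cons_mem_S.2 ⟨by omega, h2⟩, by simp⟩
    · rintro (⟨g, hg, h3⟩ | ⟨g, hg, h3⟩)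
      · rw [← Fin.cons_self_tail g, cons_mem_S] at hg
        obtain ⟨h4, h5⟩ := Fin.cons_inj.1 h3
        subst h5
        exact ⟨by omega, hg.2⟩
      · rw [mem_S] at hg
        obtain ⟨h4, h5⟩ := Fin.cons_inj.1 h3
        subst h5
        exact ⟨by omega, by omega⟩
  have h2 : Disjoint ((S (n+1) k m).image (fun e => (Fin.cons (e 0 + 1) (Fin.tail e) : Fin (n+2) → ℕ)))
      ((S n (k+1) (m - (k+1))).image (fun e => (Fin.cons 0 e : Fin (n+2) → ℕ))) := by
    rw [Finset.disjoint_left]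
    intro e he he2
    simp only [Finset.mem_image] at he he2
    obtain ⟨f, _, rfl⟩ := he
    obtain ⟨g, _, hg⟩ := he2
    have := congrFun hg 0
    simp at this
  rw [a, h1, Finset.card_union_of_disjoint h2, Finset.card_image_of_injective, Finset.card_image_of_injective]
  · rfl
  · intro e f h
    exact Fin.cons_right_injective (α := fun _ => ℕ) 0 h
  · intro e f h
    have h' := Fin.cons_inj.1 h
    funext i
    refine Fin.cases ?_ (fun i => ?_) i
    · have := h'.1; omega
    · exact congrFun h'.2 i

lemma a_rec' (n k : ℕ) (m : ℤ) :
    a (n+1) (k+1) m = a n (k+1) m + a (n+1) k (m - (n+1)) := by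
  rw [a_rev, a_rec, add_comm, a_rev n, a_rev (n+1) k]
  congr 2 <;> (push_cast; ring)

lemma a_symm (n k : ℕ) : ∀ m, a n k m = a k n m := by
  induction n generalizing k with
  | zero => intro m; rw [a_zero_left, a_zero_right]
  | succ n ihn =>
    induction k with
    | zero => intro m; rw [a_zero_left, a_zero_right]
    | succ k ihk =>
      intro m
      rw [a_rec, a_rec' k n, ihk, ihn]

lemma a_zero (n k : ℕ) : a n k 0 = 1 := by
  have h := a_zero_right n 0
  induction n generalizing k with
  | zero => rw [a_zero_left]; simp
  | succ n ih =>
    induction k with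
    | zero => simpa using h
    | succ k ihk => rw [a_rec, ihk, a_neg (by omega)]

lemma a_one (n k : ℕ) : a (n+1) (k+1) 1 = 1 := by
  induction k with
  | zero =>
    rw [a_rec, a_zero_right]
    simp [a_zero]
  | succ k ihk => rw [a_rec, ihk, a_neg (by push_cast; omega)]

lemma a_big {n k : ℕ} {m : ℤ} (hm : n * k < m) : a n k m = 0 := by
  rw [a_rev, a_neg (by omega)]

lemma p_eq (n k m : ℕ) : p k n m = a n k m := by
  classical
  rw [p, Fintype.card_subtype, a]
  refine Finset.card_bij (fun π _ => (Fin.cons (k - π.parts.card) (fun j : Fin n => π.parts.count (j.1+1)) : Fin (n+1) → ℕ))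
    ?_ ?_ ?_
  · intro π hπ
    obtain ⟨h1, h2⟩ := (Finset.mem_filter.1 hπ).2
    have hsub : ∀ x ∈ π.parts, x ∈ Finset.image (fun j : Fin n => j.1 + 1) Finset.univ := by
      intro x hx
      have := h2 x hx
      have := π.parts_pos hx
      simp only [Finset.mem_image, Finset.mem_univ, true_and]
      exact ⟨⟨x - 1, by omega⟩, by simp; omega⟩
    have hinj : Function.Injective (fun j : Fin n => j.1 + 1) := by
      intro i j hij; ext; simpa using hij
    have hc : ∑ j : Fin n, π.parts.count (j.1+1) = π.parts.card := by
      rw [← Multiset.sum_count_eq_card hsub, Finset.sum_image (fun _ _ _ _ h => hinj h)]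
    have hs : ∑ j : Fin n, (j.1+1) * π.parts.count (j.1+1) = m := by
      conv_rhs => rw [← π.parts_sum]
      rw [Finset.sum_multiset_count_of_subset _ (Finset.image (fun j : Fin n => j.1 + 1) Finset.univ)
        (fun x hx => hsub x (Multiset.mem_toFinset.1 hx)), Finset.sum_image (fun _ _ _ _ h => hinj h)]
      simp [mul_comm]
    rw [mem_S, Fin.sum_univ_succ, Fin.sum_univ_succ]
    simp only [Fin.cons_zero, Fin.cons_succ, Fin.val_zero, Fin.val_succ, zero_mul, zero_add, hc, hs]
    exact ⟨by omega, trivial⟩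
  · intro π hπ ρ hρ h
    obtain ⟨h1, h2⟩ := (Finset.mem_filter.1 hπ).2
    obtain ⟨h3, h4⟩ := (Finset.mem_filter.1 hρ).2
    have h' := (Fin.cons_inj.1 h).2
    apply Nat.Partition.ext
    ext x
    by_cases hx : x = 0
    · subst hx
      rw [Multiset.count_eq_zero_of_notMem (fun h => (π.parts_pos h).ne' rfl),
        Multiset.count_eq_zero_of_notMem (fun h => (ρ.parts_pos h).ne' rfl)]
    by_cases hx2 : n < x
    · rw [Multiset.count_eq_zero_of_notMem (fun h => absurd (h2 _ h) (by omega)),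
        Multiset.count_eq_zero_of_notMem (fun h => absurd (h4 _ h) (by omega))]
    · have := congrFun h' ⟨x - 1, by omega⟩
      simp only at this
      rwa [show x - 1 + 1 = x by omega] at this
  · intro e he
    rw [mem_S, Fin.sum_univ_succ, Fin.sum_univ_succ] at he
    simp only [Fin.val_zero, Fin.val_succ, zero_mul, zero_add] at he
    obtain ⟨h1, h2⟩ := he
    have h2' : ∑ i : Fin n, (i.1+1) * e i.succ = m := by exact_mod_cast h2
    let s : Multiset ℕ := ∑ i : Fin n, Multiset.replicate (e i.succ) (i.1 + 1)
    have hmem : ∀ x ∈ s, 0 < x ∧ x ≤ n := by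
      intro x hx
      obtain ⟨i, _, hi⟩ := Multiset.mem_sum.1 hx
      have := Multiset.eq_of_mem_replicate hi
      omega
    have hcard : s.card = ∑ i : Fin n, e i.succ := by simp [s]
    refine ⟨⟨s, fun {x} hx => (hmem x hx).1, ?_⟩, ?_, ?_⟩
    · rw [← h2']
      simp [s, Multiset.sum_sum, mul_comm]
    · refine Finset.mem_filter.2 ⟨Finset.mem_univ _, ?_, fun j hj => (hmem j hj).2⟩
      simp only [hcard]; omega
    · funext i
      refine Fin.cases ?_ (fun i => ?_) i
      · simp only [Fin.cons_zero, hcard]; omega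
      · simp only [Fin.cons_succ, s, Multiset.count_sum', Multiset.count_replicate]
        rw [Finset.sum_eq_single i]
        · simp
        · intro b _ hb
          rw [if_neg]
          intro h; apply hb; ext; omega
        · simp

/-- coefficientwise addition -/
def addL : List ℕ → List ℕ → List ℕ
  | [], l => l
  | x :: xs, [] => x :: xs
  | x :: xs, y :: ys => (x + y) :: addL xs ys

/-- multiplication by a power of `q` -/
def shiftL : ℕ → List ℕ → List ℕ
  | 0, l => l
  | k+1, l => 0 :: shiftL k l

/-- one row of the table from the previous one -/
def goRow : ℕ → List ℕ → List (List ℕ) → List (List ℕ)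
  | _, _, [] => []
  | k, acc, q :: rest => addL acc (shiftL k q) :: goRow (k+1) (addL acc (shiftL k q)) rest

/-- table of coefficient lists, `k = 0, ..., 15` -/
def row : ℕ → List (List ℕ)
  | 0 => List.replicate 16 [1]
  | n+1 => [1] :: goRow 1 [1] (row n).tail

/-- strict increase of the first `t` steps -/
def scan : ℕ → List ℕ → Bool
  | 0, _ => true
  | _+1, [] => false
  | _+1, [_] => false
  | t+1, x :: y :: l => Nat.blt x y && scan t (y :: l)

/-- check of one coefficient list -/
def chk (n k : ℕ) (l : List ℕ) : Bool :=
  scan (n * k / 2 - 1) l.tail &&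
    (Nat.beq (n * k % 2) 1 || Nat.ble (l.getD (n * k / 2 - 1) 0 + 2) (l.getD (n * k / 2) 0))

/-- check of a row -/
def chkRow : ℕ → ℕ → List (List ℕ) → Bool
  | _, _, [] => true
  | n, k, l :: r => chk n k l && chkRow n (k+1) r

lemma base8 : chkRow 8 8 ((row 8).drop 8) = true := by decide +kernel
lemma base9 : chkRow 9 8 ((row 9).drop 8) = true := by decide +kernel
lemma base10 : chkRow 10 8 ((row 10).drop 8) = true := by decide +kernel
lemma base11 : chkRow 11 8 ((row 11).drop 8) = true := by decide +kernel
lemma base12 : chkRow 12 8 ((row 12).drop 8) = true := by decide +kernel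
lemma base13 : chkRow 13 8 ((row 13).drop 8) = true := by decide +kernel
lemma base14 : chkRow 14 8 ((row 14).drop 8) = true := by decide +kernel
lemma base15 : chkRow 15 8 ((row 15).drop 8) = true := by decide +kernel

lemma getD_addL (l₁ l₂ : List ℕ) (m : ℕ) : (addL l₁ l₂).getD m 0 = l₁.getD m 0 + l₂.getD m 0 := by
  induction l₁ generalizing l₂ m with
  | nil => simp [addL]
  | cons x xs ih =>
    cases l₂ with
    | nil => simp [addL]
    | cons y ys =>
      cases m with
      | zero => simp [addL]
      | succ m => simpa [addL] using ih ys m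

lemma getD_shiftL (k : ℕ) (l : List ℕ) (m : ℕ) :
    (shiftL k l).getD m 0 = if k ≤ m then l.getD (m - k) 0 else 0 := by
  induction k generalizing m with
  | zero => simp [shiftL]
  | succ k ih =>
    cases m with
    | zero => simp [shiftL]
    | succ m => simpa [shiftL] using ih m

/-- `l` is the coefficient list of the Gaussian binomial -/
def Rep (n k : ℕ) (l : List ℕ) : Prop := ∀ m : ℕ, l.getD m 0 = a n k m

/-- every entry of the row is correct -/
def Good (n : ℕ) : ℕ → List (List ℕ) → Prop
  | _, [] => True
  | k, l :: r => Rep n k l ∧ Good n (k+1) r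

lemma rep_step {n k : ℕ} {l₁ l₂ : List ℕ} (h₁ : Rep (n+1) k l₁) (h₂ : Rep n (k+1) l₂) :
    Rep (n+1) (k+1) (addL l₁ (shiftL (k+1) l₂)) := by
  intro m
  rw [getD_addL, getD_shiftL, a_rec, h₁]
  congr 1
  split_ifs with h
  · rw [h₂, Nat.cast_sub h]; push_cast; rfl
  · rw [a_neg]; omega

lemma good_goRow {n : ℕ} (L : List (List ℕ)) : ∀ {k : ℕ} {acc : List ℕ}, Rep (n+1) k acc →
    Good n (k+1) L → Good (n+1) (k+1) (goRow (k+1) acc L) := by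
  induction L with
  | nil => intros; trivial
  | cons q r ih =>
    intro k acc h1 h2
    have := rep_step h1 h2.1
    exact ⟨this, ih this h2.2⟩

lemma rep_one_right (n : ℕ) : Rep n 0 [1] := by
  intro m
  rw [a_zero_right]
  cases m with
  | zero => simp
  | succ m => rw [if_neg (by push_cast; omega)]; simp

lemma rep_one_left (k : ℕ) : Rep 0 k [1] := by
  intro m
  rw [a_symm]
  exact rep_one_right k m

lemma good_replicate (t : ℕ) : ∀ k, Good 0 k (List.replicate t [1]) := by
  induction t with
  | zero => intro k; trivial
  | succ t ih => intro k; exact ⟨rep_one_left k, ih (k+1)⟩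

lemma good_tail {n k : ℕ} {L : List (List ℕ)} (h : Good n k L) : Good n (k+1) L.tail := by
  cases L with
  | nil => trivial
  | cons l r => exact h.2

lemma good_row (n : ℕ) : Good n 0 (row n) := by
  induction n with
  | zero => exact good_replicate 16 0
  | succ n ih => exact ⟨rep_one_right _, good_goRow _ (rep_one_right _) (good_tail ih)⟩

lemma good_drop {n : ℕ} (t : ℕ) : ∀ {k : ℕ} {L : List (List ℕ)}, Good n k L → Good n (k+t) (L.drop t) := by
  induction t with
  | zero => intro k L h; simpa using h
  | succ t ih =>
    intro k L h
    have := ih (good_tail h)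
    rw [List.drop_tail, add_assoc, add_comm 1 t] at this
    exact this

lemma goRow_length (L : List (List ℕ)) : ∀ k acc, (goRow k acc L).length = L.length := by
  induction L with
  | nil => intros; rfl
  | cons q r ih => intro k acc; simp [goRow, ih]

lemma row_length (n : ℕ) : (row n).length = 16 := by
  induction n with
  | zero => simp [row]
  | succ n ih => simp [row, goRow_length, ih]

lemma scan_spec (t : ℕ) : ∀ {l : List ℕ}, scan t l = true → ∀ i < t, l.getD i 0 < l.getD (i+1) 0 := by
  induction t with
  | zero => intro l _ i hi; omega
  | succ t ih =>
    intro l h i hi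
    match l, h with
    | x :: y :: l, h =>
      rw [scan, Bool.and_eq_true] at h
      cases i with
      | zero =>
        have h1 := h.1
        rw [Nat.blt_eq] at h1
        simpa using h1
      | succ i =>
        have := ih h.2 i (by omega)
        simpa using this

/-- strict unimodality -/
def SU (n k : ℕ) : Prop := ∀ m : ℤ, 2 ≤ m → 2 * m ≤ n * k → a n k (m - 1) < a n k m

/-- jump at least two in the middle -/
def MT (n k : ℕ) : Prop := ∀ m : ℤ, 2 * m = n * k → a n k (m - 1) + 2 ≤ a n k m

lemma chk_spec {n k : ℕ} (hn : 0 < n * k) {l : List ℕ} (hr : Rep n k l) (h : chk n k l = true) :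
    SU n k ∧ MT n k := by
  rw [chk, Bool.and_eq_true, Bool.or_eq_true, Nat.beq_eq, Nat.ble_eq] at h
  obtain ⟨h1, h2⟩ := h
  constructor
  · intro m hm hm2
    obtain ⟨j, rfl⟩ : ∃ j : ℕ, m = j + 2 := ⟨(m - 2).toNat, by omega⟩
    have hm3 : 2 * (j + 2) ≤ n * k := by exact_mod_cast hm2
    have := scan_spec _ h1 j (by omega)
    have e : ∀ i, l.tail.getD i 0 = l.getD (i+1) 0 := by intro i; cases l <;> simp
    rw [e, e, hr, hr] at this
    have e3 : (j : ℤ) + 2 - 1 = ((j + 1 : ℕ) : ℤ) := by push_cast; ring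
    have e4 : (j : ℤ) + 2 = ((j + 1 + 1 : ℕ) : ℤ) := by push_cast; ring
    rw [e3, e4]
    exact this
  · intro m hm
    have hpos : (0 : ℤ) < n * k := by exact_mod_cast hn
    obtain ⟨j, rfl⟩ : ∃ j : ℕ, m = j + 1 := ⟨(m - 1).toNat, by omega⟩
    have hm3 : 2 * (j + 1) = n * k := by exact_mod_cast hm
    have e1 : n * k / 2 = j + 1 := by omega
    have e2 : n * k % 2 ≠ 1 := by omega
    have h3 := h2.resolve_left e2
    rw [e1, hr, hr] at h3
    have e3 : (j : ℤ) + 1 - 1 = ((j + 1 - 1 : ℕ) : ℤ) := by simp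
    have e4 : (j : ℤ) + 1 = ((j + 1 : ℕ) : ℤ) := by push_cast; ring
    rw [e3, e4]
    exact h3

lemma chkRow_spec {n : ℕ} (hn : 0 < n) (L : List (List ℕ)) : ∀ {k : ℕ}, 0 < k → Good n k L →
    chkRow n k L = true → ∀ i < L.length, SU n (k+i) ∧ MT n (k+i) := by
  induction L with
  | nil => intro k _ _ _ i hi; simp at hi
  | cons l r ih =>
    intro k hk hg hc i hi
    rw [chkRow, Bool.and_eq_true] at hc
    cases i with
    | zero => exact chk_spec (Nat.mul_pos hn hk) hg.1 hc.1
    | succ i =>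
      have := ih (Nat.succ_pos k) hg.2 hc.2 i (by simpa using hi)
      rwa [show k + 1 + i = k + (i + 1) by omega] at this

lemma base {n k : ℕ} (hn : 8 ≤ n) (hn' : n ≤ 15) (hk : 8 ≤ k) (hk' : k ≤ 15) : SU n k ∧ MT n k := by
  have key : chkRow n 8 ((row n).drop 8) = true := by
    interval_cases n
    exacts [base8, base9, base10, base11, base12, base13, base14, base15]
  have hg : Good n 8 ((row n).drop 8) := by simpa using good_drop 8 (good_row n)
  have := chkRow_spec (by omega) _ (by omega) hg key (k - 8)
    (by rw [List.length_drop, row_length]; omega)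
  rwa [show 8 + (k - 8) = k by omega] at this

lemma SU.symm {n k : ℕ} (h : SU n k) : SU k n := by
  intro m h1 h2
  rw [a_symm k n, a_symm k n]
  exact h m h1 (by linarith)

lemma MT.symm {n k : ℕ} (h : MT n k) : MT k n := by
  intro m h1
  rw [a_symm k n, a_symm k n]
  exact h m (by linarith)

lemma SU.c_pos {n k : ℕ} (h : SU n k) {m : ℤ} (h1 : m = 0 ∨ 2 ≤ m) (h2 : 2 * m ≤ n * k) :
    0 < c n k m := by
  have := a_eq (n := n) (k := k) (m := m) (by linarith)
  rcases h1 with rfl | h1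
  · rw [a_zero, a_neg (by omega)] at this; omega
  · have := h m h1 h2; omega

lemma SU_step {n k : ℕ} (hn : 8 ≤ n) (hk : 8 ≤ k) (h : SU n k) (h8 : SU n 8) : SU n (8 + k) := by
  intro m hm hm2
  have h64 : (64 : ℤ) ≤ n * k := by
    have : 8 * 8 ≤ n * k := Nat.mul_le_mul hn hk
    exact_mod_cast this
  have e8 : (n : ℤ) * ((8 + k : ℕ) : ℤ) = 8 * n + n * k := by push_cast; ring
  rw [e8] at hm2
  have hA := a_eq (n := n) (k := 8 + k) (m := m) (by rw [e8]; linarith)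
  suffices 0 < c n (8 + k) m by omega
  generalize hN : (n : ℤ) * k = N at *
  obtain ⟨m₁, m₂, rfl, h1, h2, h3, h4⟩ : ∃ m₁ m₂ : ℤ, m = m₁ + m₂ ∧ (m₁ = 0 ∨ 2 ≤ m₁) ∧
      2 * m₁ ≤ n * 8 ∧ (m₂ = 0 ∨ 2 ≤ m₂) ∧ 2 * m₂ ≤ N := by
    by_cases c1 : m ≤ N / 2
    · exact ⟨0, m, by omega, by omega, by omega, by omega, by omega⟩
    by_cases c2 : m = N / 2 + 1
    · exact ⟨2, N / 2 - 1, by omega, by omega, by omega, by omega, by omega⟩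
    · exact ⟨m - N / 2, N / 2, by omega, by omega, by omega, by omega, by omega⟩
  exact lt_of_lt_of_le (h.c_pos h3 (by rw [hN]; exact h4)) (c_le (h8.c_pos h1 (by exact_mod_cast h2)))

lemma MT_step {n k : ℕ} (h : MT n k) (h8 : SU n 8) (hn : 8 ≤ n) : MT n (8 + k) := by
  intro m hm
  have e8 : (n : ℤ) * ((8 + k : ℕ) : ℤ) = 8 * n + n * k := by push_cast; ring
  rw [e8] at hm
  have hA := a_eq (n := n) (k := 8 + k) (m := m) (by rw [e8]; linarith)
  have hB := a_eq (n := n) (k := k) (m := m - 4 * n) (by linarith)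
  have hC := h (m - 4 * n) (by linarith)
  have hD := c_le (k₂ := k) (m₂ := m - 4 * n) (h8.c_pos (m := 4 * n) (Or.inr (by omega)) (by push_cast; linarith))
  rw [add_sub_cancel] at hD
  omega

lemma both_aux {n : ℕ} (hn : 8 ≤ n) (hb : ∀ k, 8 ≤ k → k ≤ 15 → SU n k ∧ MT n k) :
    ∀ k, 8 ≤ k → SU n k ∧ MT n k := by
  intro k
  induction k using Nat.strong_induction_on with
  | _ k ih =>
    intro hk
    by_cases h : k ≤ 15
    · exact hb k hk h
    · obtain ⟨j, rfl⟩ : ∃ j, k = 8 + j := ⟨k - 8, by omega⟩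
      have h1 := ih j (by omega) (by omega)
      have h8 := (hb 8 le_rfl (by omega)).1
      exact ⟨SU_step hn (by omega) h1.1 h8, MT_step h1.2 h8 hn⟩

lemma both {n k : ℕ} (hn : 8 ≤ n) (hk : 8 ≤ k) : SU n k ∧ MT n k := by
  refine both_aux hn (fun k hk hk' => ?_) k hk
  have := both_aux hk (fun n hn hn' => base hk hk' hn hn') n hn
  exact ⟨this.1.symm, this.2.symm⟩

lemma gauss_coeff (n k m : ℕ) : (gauss n k).coeff m = (a n k m : ℤ) := by
  rw [gauss, Polynomial.finsetSum_coeff]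
  simp only [Polynomial.coeff_C_mul, Polynomial.coeff_X_pow, mul_ite, mul_one, mul_zero, p_eq]
  rw [Finset.sum_ite_eq]
  split_ifs with h
  · rfl
  · rw [a_big]
    · rfl
    · simp only [Finset.mem_range] at h
      have : n * k < m := by omega
      exact_mod_cast this

lemma G_coeff (n k k' N m : ℕ) :
    (gauss n k - Polynomial.X ^ N * gauss n k').coeff m = (a n k m : ℤ) - (a n k' ((m : ℤ) - N) : ℤ) := by
  rw [Polynomial.coeff_sub, gauss_coeff, Polynomial.coeff_X_pow_mul']
  split_ifs with h
  · rw [gauss_coeff, Nat.cast_sub h]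
  · rw [a_neg (m := (m : ℤ) - N) (by omega)]; rfl

end GSU

open Polynomial in
/-- For $n, r ≥ 8$ with at least one of $n,r$ even and $k ≥ r$, the polynomial
$G_{n,k,r}(q) = [n+k,k]_q - q^{nr/2}[n+k-r,k-r]_q = \sum_m g_m q^m$ satisfies
$g_0 = g_1 = 1$, $g_{nk-1} = g_{nk} = 1$, $g_m = g_{nk-m}$, and
$g_{m-1} < g_m$ for $2 ≤ m ≤ nk/2$. -/
theorem G_symmetric_strictly_unimodal (n r k : ℕ) (hn : 8 ≤ n) (hr : 8 ≤ r)
    (hpar : Even n ∨ Even r) (hk : r ≤ k) :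
    let G : Polynomial ℤ := gauss n k - Polynomial.X ^ (n * r / 2) * gauss n (k - r)
    G.coeff 0 = 1 ∧ G.coeff 1 = 1 ∧
    G.coeff (n * k - 1) = 1 ∧ G.coeff (n * k) = 1 ∧
    (∀ m : ℕ, m ≤ n * k → G.coeff m = G.coeff (n * k - m)) ∧
    (∀ m : ℕ, 2 ≤ m → 2 * m ≤ n * k → G.coeff (m - 1) < G.coeff m) := by
  intro G
  have hG : ∀ m : ℕ, G.coeff m = (GSU.a n k m : ℤ) - (GSU.a n (k - r) ((m : ℤ) - (n * r / 2 : ℕ)) : ℤ) :=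
    fun m => GSU.G_coeff _ _ _ _ _
  obtain ⟨j, rfl⟩ : ∃ j, k = r + j := ⟨k - r, by omega⟩
  rw [Nat.add_sub_cancel_left] at hG
  have hN : 2 * (n * r / 2) = n * r := by
    have : Even (n * r) := by
      rcases hpar with h | h
      · exact h.mul_right r
      · exact h.mul_left n
    exact Nat.two_mul_div_two_of_even this
  have h64 : 8 * 8 ≤ n * r := Nat.mul_le_mul hn hr
  generalize n * r / 2 = N at *
  have hNz : (2 * N : ℤ) = n * r := by exact_mod_cast hN
  have hsym : ∀ m : ℕ, m ≤ n * (r + j) → G.coeff m = G.coeff (n * (r + j) - m) := by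
    intro m hm
    rw [hG, hG, Nat.cast_sub hm, GSU.a_rev n (r+j), GSU.a_rev n j]
    congr 3
    push_cast
    linarith
  have h0 : G.coeff 0 = 1 := by
    rw [hG, GSU.a_neg (m := ((0 : ℕ) : ℤ) - N) (by push_cast; omega), Nat.cast_zero, GSU.a_zero]; rfl
  have h1 : G.coeff 1 = 1 := by
    rw [hG, GSU.a_neg (m := ((1 : ℕ) : ℤ) - N) (by push_cast; omega), Nat.cast_one]
    obtain ⟨n', rfl⟩ : ∃ n', n = n' + 1 := ⟨n - 1, by omega⟩
    obtain ⟨k', hk'⟩ : ∃ k', r + j = k' + 1 := ⟨r + j - 1, by omega⟩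
    rw [hk', GSU.a_one]; rfl
  have hbig : n * r ≤ n * (r + j) := Nat.mul_le_mul_left _ (by omega)
  refine ⟨h0, h1, ?_, ?_, hsym, ?_⟩
  · rw [← hsym 1 (by omega)]; exact h1
  · have := hsym 0 (by omega)
    rw [Nat.sub_zero] at this
    rw [← this]; exact h0
  · intro m hm hm2
    have hm2z : (2 * m : ℤ) ≤ n * r + n * j := by
      have : 2 * m ≤ n * r + n * j := by rw [← Nat.mul_add]; exact hm2
      exact_mod_cast this
    rw [hG, hG, Nat.cast_sub (by omega)]
    have hA := GSU.a_eq (n := n) (k := r + j) (m := m) (by push_cast; linarith)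
    have hB := GSU.a_eq (n := n) (k := j) (m := (m : ℤ) - N) (by linarith)
    have hC := GSU.a_eq (n := n) (k := r) (m := N) (by linarith)
    have hD := (GSU.both hn hr).2 N hNz
    have hE := (GSU.both hn (show 8 ≤ r + j by omega)).1 m (by exact_mod_cast hm) (by exact_mod_cast hm2)
    have hF : GSU.c n j ((m : ℤ) - N) < GSU.c n (r + j) m := by
      rcases Nat.eq_zero_or_pos (GSU.c n j ((m : ℤ) - N)) with h | h
      · omega
      · have := GSU.c_lt (k₁ := r) (m₁ := N) (by omega) h
        rwa [add_sub_cancel] at this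
    rw [show ((m : ℤ) - (1 : ℕ) - N) = (m : ℤ) - N - 1 by push_cast; ring, Nat.cast_one]
    omega
end

section
/- Let n, r ≥ 8 with at least one of n and r even. Then p(r,n,nr/2) − p(r,n,nr/2 − 1) ≥ 2, i.e., there are at least two linearly independent semi-invariants of a binary n-form of degree r and weight nr/2. -/
/-- Multisets of exactly `k` naturals, each at most `n`, with sum `m`. -/
def boxSet (k n m : ℕ) : Set (Multiset ℕ) :=
  {s | s.card = k ∧ (∀ j ∈ s, j ≤ n) ∧ s.sum = m}

def partEquivBox (k n m : ℕ) :
    {π : Nat.Partition m // π.parts.card ≤ k ∧ ∀ j ∈ π.parts, j ≤ n} ≃ boxSet k n m where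
  toFun π := ⟨π.1.parts + Multiset.replicate (k - π.1.parts.card) 0, by
    obtain ⟨π, h1, h2⟩ := π
    refine ⟨?_, ?_, ?_⟩
    · simp; omega
    · intro j hj
      rw [Multiset.mem_add] at hj
      rcases hj with hj | hj
      · exact h2 j hj
      · have := Multiset.eq_of_mem_replicate hj
        omega
    · simp [π.parts_sum]⟩
  invFun s := ⟨⟨s.1.filter (fun j => j ≠ 0), by
      intro i hi
      have := (Multiset.mem_filter.1 hi).2
      omega, by
      obtain ⟨s, h1, h2, h3⟩ := s
      have h := congrArg Multiset.sum (Multiset.filter_add_not (fun j : ℕ => j ≠ 0) s)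
      have h0 : (Multiset.filter (fun j : ℕ => ¬ j ≠ 0) s).sum = 0 := by
        apply Multiset.sum_eq_zero
        intro x hx
        have := (Multiset.mem_filter.1 hx).2
        omega
      rw [Multiset.sum_add, h0, h3] at h
      simpa using h⟩, by
      obtain ⟨s, h1, h2, h3⟩ := s
      refine ⟨?_, ?_⟩
      · exact (Multiset.card_le_card (Multiset.filter_le _ _)).trans h1.le
      · intro j hj
        exact h2 j (Multiset.mem_filter.1 hj).1⟩
  left_inv := by
    rintro ⟨π, h1, h2⟩
    apply Subtype.ext
    apply Nat.Partition.ext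
    simp only [Multiset.filter_add]
    have e1 : Multiset.filter (fun j => j ≠ 0) π.parts = π.parts := by
      rw [Multiset.filter_eq_self]
      intro a ha
      have := π.parts_pos ha
      omega
    have e2 : Multiset.filter (fun j => j ≠ 0) (Multiset.replicate (k - π.parts.card) 0) = 0 := by
      rw [Multiset.filter_eq_nil]
      intro a ha
      have := Multiset.eq_of_mem_replicate ha
      omega
    rw [e1, e2, add_zero]
  right_inv := by
    rintro ⟨s, h1, h2, h3⟩
    apply Subtype.ext
    simp only
    have h := (Multiset.filter_add_not (fun j : ℕ => j ≠ 0) s)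
    have hr : Multiset.filter (fun j : ℕ => ¬ j ≠ 0) s
        = Multiset.replicate (k - (Multiset.filter (fun j : ℕ => j ≠ 0) s).card) 0 := by
      rw [Multiset.eq_replicate]
      have hc := congrArg Multiset.card h
      rw [Multiset.card_add] at hc
      refine ⟨by omega, ?_⟩
      intro b hb
      have := (Multiset.mem_filter.1 hb).2
      omega
    rw [← hr]
    exact h

lemma boxSet_finite (k n m : ℕ) : (boxSet k n m).Finite :=
  Set.finite_coe_iff.1 (Finite.of_equiv _ (partEquivBox k n m))

lemma p_eq (k n m : ℕ) : p k n m = (boxSet k n m).ncard := by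
  rw [p, ← Nat.card_eq_fintype_card, Nat.card_congr (partEquivBox k n m), Nat.card_coe_set_eq]

lemma p_zero_left (n m : ℕ) : p 0 n m = if m = 0 then 1 else 0 := by
  rw [p_eq]
  split_ifs with h
  · subst h
    rw [Set.ncard_eq_one]
    refine ⟨0, ?_⟩
    ext s
    simp only [boxSet, Set.mem_ofPred_eq, Set.mem_singleton_iff, Multiset.card_eq_zero]
    constructor
    · exact fun h => h.1
    · rintro rfl; simp
  · have : boxSet 0 n m = ∅ := by
      ext s
      simp only [boxSet, Set.mem_ofPred_eq, Set.mem_empty_iff_false, Multiset.card_eq_zero, iff_false]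
      rintro ⟨rfl, h1, h2⟩
      simp at h2
      omega
    simp [this]

lemma p_zero_mid (k m : ℕ) : p k 0 m = if m = 0 then 1 else 0 := by
  rw [p_eq]
  have key : ∀ s : Multiset ℕ, (s.card = k ∧ ∀ j ∈ s, j ≤ 0) ↔ s = Multiset.replicate k 0 := by
    intro s
    rw [Multiset.eq_replicate]
    simp
  split_ifs with h
  · subst h
    rw [Set.ncard_eq_one]
    refine ⟨Multiset.replicate k 0, ?_⟩
    ext s
    simp only [boxSet, Set.mem_ofPred_eq, Set.mem_singleton_iff, ← and_assoc, key]
    constructor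
    · exact fun h => h.1
    · rintro rfl; simp
  · have : boxSet k 0 m = ∅ := by
      ext s
      simp only [boxSet, Set.mem_ofPred_eq, Set.mem_empty_iff_false, ← and_assoc, key, iff_false]
      rintro ⟨rfl, h2⟩
      simp at h2
      omega
    simp [this]

/-- Split according to whether `0` occurs. -/
lemma p_rec1 (k n m : ℕ) : p (k+1) (n+1) m
    = p k (n+1) m + if k + 1 ≤ m then p (k+1) n (m - (k+1)) else 0 := by
  have hB : (if k + 1 ≤ m then p (k+1) n (m - (k+1)) else 0)
      = {s | s ∈ boxSet (k+1) (n+1) m ∧ 0 ∉ s}.ncard := by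
    have hsum : ∀ t : Multiset ℕ, (t.map Nat.succ).sum = t.sum + t.card := by
      intro t
      induction t using Multiset.induction_on with
      | empty => simp
      | cons a t ih => simp [ih]; omega
    have hpred : ∀ s : Multiset ℕ, 0 ∉ s → (s.map Nat.pred).map Nat.succ = s := by
      intro s hs
      rw [Multiset.map_map]
      conv_rhs => rw [← Multiset.map_id s]
      apply Multiset.map_congr rfl
      intro x hx
      have : x ≠ 0 := fun h => hs (h ▸ hx)
      simp; omega
    split_ifs with h
    · rw [p_eq, ← Set.ncard_image_of_injective _ (Multiset.map_injective Nat.succ_injective)]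
      congr 1
      ext s
      constructor
      · rintro ⟨t, ⟨h1, h2, h3⟩, rfl⟩
        refine ⟨⟨by simpa using h1, ?_, ?_⟩, by simp⟩
        · intro j hj
          obtain ⟨i, hi, rfl⟩ := Multiset.mem_map.1 hj
          have := h2 i hi
          omega
        · rw [hsum]; omega
      · rintro ⟨⟨h1, h2, h3⟩, h0⟩
        refine ⟨s.map Nat.pred, ⟨by simpa using h1, ?_, ?_⟩, hpred s h0⟩
        · intro j hj
          obtain ⟨i, hi, rfl⟩ := Multiset.mem_map.1 hj
          have := h2 i hi
          simp; omega
        · have := hsum (s.map Nat.pred)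
          rw [hpred s h0, Multiset.card_map] at this
          omega
    · symm
      rw [Set.ncard_eq_zero ((boxSet_finite (k+1) (n+1) m).subset fun s hs => hs.1)]
      ext s
      simp only [Set.mem_ofPred_eq, Set.mem_empty_iff_false, iff_false]
      rintro ⟨⟨h1, h2, h3⟩, h0⟩
      have := hsum (s.map Nat.pred)
      rw [hpred s h0, Multiset.card_map] at this
      omega
  have hA : p k (n+1) m = {s | s ∈ boxSet (k+1) (n+1) m ∧ 0 ∈ s}.ncard := by
    rw [p_eq, ← Set.ncard_image_of_injective _ (fun s t h => (Multiset.cons_inj_right 0).1 h)]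
    congr 1
    ext s
    constructor
    · rintro ⟨t, ⟨h1, h2, h3⟩, rfl⟩
      refine ⟨⟨by simpa using h1, ?_, by simpa using h3⟩, by simp⟩
      intro j hj
      rcases Multiset.mem_cons.1 hj with rfl | hj
      · omega
      · exact h2 j hj
    · rintro ⟨⟨h1, h2, h3⟩, h0⟩
      obtain ⟨t, rfl⟩ := Multiset.exists_cons_of_mem h0
      exact ⟨t, ⟨by simpa using h1, fun j hj => h2 j (Multiset.mem_cons_of_mem hj),
        by simpa using h3⟩, rfl⟩
  rw [hB, hA, p_eq, ← Set.ncard_union_eq ?_ ?_ ?_]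
  · congr 1
    ext s
    simp only [Set.mem_union, Set.mem_ofPred_eq]
    tauto
  · rw [Set.disjoint_left]
    exact fun s hs ht => ht.2 hs.2
  · exact (boxSet_finite (k+1) (n+1) m).subset fun s hs => hs.1
  · exact (boxSet_finite (k+1) (n+1) m).subset fun s hs => hs.1

/-- Split according to whether `n + 1` occurs. -/
lemma p_rec2 (k n m : ℕ) : p (k+1) (n+1) m
    = p (k+1) n m + if n + 1 ≤ m then p k (n+1) (m - (n+1)) else 0 := by
  have hA : p (k+1) n m = {s | s ∈ boxSet (k+1) (n+1) m ∧ n+1 ∉ s}.ncard := by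
    rw [p_eq]
    congr 1
    ext s
    constructor
    · rintro ⟨h1, h2, h3⟩
      refine ⟨⟨h1, fun j hj => (h2 j hj).trans (by omega), h3⟩, fun h => ?_⟩
      have := h2 _ h
      omega
    · rintro ⟨⟨h1, h2, h3⟩, h0⟩
      refine ⟨h1, fun j hj => ?_, h3⟩
      have := h2 j hj
      have : j ≠ n + 1 := fun h => h0 (h ▸ hj)
      omega
  have hB : (if n + 1 ≤ m then p k (n+1) (m - (n+1)) else 0)
      = {s | s ∈ boxSet (k+1) (n+1) m ∧ n+1 ∈ s}.ncard := by
    split_ifs with h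
    · rw [p_eq, ← Set.ncard_image_of_injective _ (fun s t h => (Multiset.cons_inj_right (n+1)).1 h)]
      congr 1
      ext s
      constructor
      · rintro ⟨t, ⟨h1, h2, h3⟩, rfl⟩
        refine ⟨⟨by simpa using h1, ?_, by rw [Multiset.sum_cons]; omega⟩, by simp⟩
        intro j hj
        rcases Multiset.mem_cons.1 hj with rfl | hj
        · omega
        · exact h2 j hj
      · rintro ⟨⟨h1, h2, h3⟩, h0⟩
        obtain ⟨t, rfl⟩ := Multiset.exists_cons_of_mem h0
        rw [Multiset.sum_cons] at h3
        exact ⟨t, ⟨by simpa using h1, fun j hj => h2 j (Multiset.mem_cons_of_mem hj),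
          by omega⟩, rfl⟩
    · symm
      rw [Set.ncard_eq_zero ((boxSet_finite (k+1) (n+1) m).subset fun s hs => hs.1)]
      ext s
      simp only [Set.mem_ofPred_eq, Set.mem_empty_iff_false, iff_false]
      rintro ⟨⟨h1, h2, h3⟩, h0⟩
      obtain ⟨t, rfl⟩ := Multiset.exists_cons_of_mem h0
      rw [Multiset.sum_cons] at h3
      omega
  rw [hB, hA, p_eq, ← Set.ncard_union_eq ?_ ?_ ?_]
  · congr 1
    ext s
    simp only [Set.mem_union, Set.mem_ofPred_eq]
    tauto
  · rw [Set.disjoint_left]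
    exact fun s hs ht => hs.2 ht.2
  · exact (boxSet_finite (k+1) (n+1) m).subset fun s hs => hs.1
  · exact (boxSet_finite (k+1) (n+1) m).subset fun s hs => hs.1

/-- Conjugation symmetry (Hermite reciprocity on the level of dimensions). -/
lemma p_symm : ∀ k n m : ℕ, p k n m = p n k m
  | 0, n, m => by rw [p_zero_left, p_zero_mid]
  | k+1, 0, m => by rw [p_zero_left, p_zero_mid]
  | k+1, n+1, m => by
    rw [p_rec1, p_rec2, p_symm k (n+1) m, p_symm (k+1) n (m - (k+1))]
termination_by k n => k + n

/-- One step of the evaluation recursion. -/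
def qrow (k : ℕ) (prev : ℕ → ℕ → ℕ) : ℕ → ℕ → ℕ
  | 0 => fun m => bif Nat.beq m 0 then 1 else 0
  | n+1 => fun m => prev (n+1) m + bif Nat.ble (k+1) m then qrow k prev n (m-(k+1)) else 0

/-- Computable version of `p`. -/
def qbox : ℕ → ℕ → ℕ → ℕ
  | 0 => fun _ m => bif Nat.beq m 0 then 1 else 0
  | k+1 => qrow k (qbox k)

lemma cond_beq (m : ℕ) : (bif Nat.beq m 0 then 1 else 0) = if m = 0 then 1 else 0 := by
  cases m <;> rfl

lemma cond_ble (a m x : ℕ) : (bif Nat.ble a m then x else 0) = if a ≤ m then x else 0 := by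
  by_cases h : a ≤ m
  · rw [Nat.ble_eq_true_of_le h, if_pos h]; rfl
  · rw [if_neg h, Bool.eq_false_iff.2 (fun h' => h (Nat.le_of_ble_eq_true h'))]; rfl

lemma p_eq_qbox : ∀ k n m : ℕ, p k n m = qbox k n m
  | 0, n, m => by rw [p_zero_left, qbox, ← cond_beq]
  | k+1, 0, m => by rw [p_zero_mid, qbox, qrow, ← cond_beq]
  | k+1, n+1, m => by
    rw [p_rec1, qbox, qrow, p_eq_qbox k (n+1) m, p_eq_qbox (k+1) n (m - (k+1)), qbox, ← cond_ble]
termination_by k n => k + n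

lemma p_le_of_ble {k n a b c : ℕ} (h : Nat.ble (qbox k n a + c) (qbox k n b) = true) :
    p k n a + c ≤ p k n b := by
  rw [p_eq_qbox, p_eq_qbox]; exact Nat.le_of_ble_eq_true h

lemma p_base1 : p 8 4 15 + 2 ≤ p 8 4 16 := p_le_of_ble (by decide +kernel)
lemma p_base2 : p 9 4 17 + 2 ≤ p 9 4 18 := p_le_of_ble (by decide +kernel)
lemma p_base3 : p 9 10 44 + 2 ≤ p 9 10 45 := p_le_of_ble (by decide +kernel)
lemma p_base4 : p 2 4 3 + 1 ≤ p 2 4 4 := p_le_of_ble (by decide +kernel)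
lemma p_base5 : p 3 4 5 + 1 ≤ p 3 4 6 := p_le_of_ble (by decide +kernel)
lemma p_base6 : p 2 2 1 + 1 ≤ p 2 2 2 := p_le_of_ble (by decide +kernel)

section SemiInvariants
open MvPolynomial

/-- Bigraded weight (degree, weight) of the coefficient `a_i`. -/
def wt (n : ℕ) (i : Fin (n+1)) : ℤ × ℤ := (1, (i : ℤ))

/-- Bihomogeneous polynomials in the coefficients of the binary `n`-form. -/
noncomputable abbrev VV (n : ℕ) (r m : ℤ) : Submodule ℚ (MvPolynomial (Fin (n+1)) ℚ) :=
  weightedHomogeneousSubmodule ℚ (wt n) (r, m)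

lemma weight_wt (n : ℕ) (d : Fin (n+1) →₀ ℕ) :
    Finsupp.weight (wt n) d = (((∑ i, d i : ℕ) : ℤ), ((∑ i : Fin (n+1), d i * (i : ℕ) : ℕ) : ℤ)) := by
  rw [Finsupp.weight_apply, Finsupp.sum_fintype _ _ (by simp)]
  ext
  · simp [wt, Prod.fst_sum]
  · simp [wt, Prod.snd_sum]

noncomputable def expEquivBox (n r m : ℕ) :
    {d : Fin (n+1) →₀ ℕ | Finsupp.weight (wt n) d = ((r : ℤ), (m : ℤ))} ≃ boxSet r n m := by
  refine Equiv.ofBijective (fun d => ⟨(Finsupp.toMultiset d.1).map (fun i : Fin (n+1) => (i : ℕ)), ?_⟩) ⟨?_, ?_⟩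
  · obtain ⟨d, hd⟩ := d
    simp only [Set.mem_ofPred_eq] at hd
    rw [weight_wt, Prod.ext_iff] at hd
    simp only [Nat.cast_inj] at hd
    refine ⟨?_, ?_, ?_⟩
    · rw [Multiset.card_map, Finsupp.card_toMultiset, Finsupp.sum_fintype _ _ (by simp)]
      simpa using hd.1
    · intro j hj
      obtain ⟨i, -, rfl⟩ := Multiset.mem_map.1 hj
      omega
    · rw [Finsupp.toMultiset_map, Finsupp.sum_toMultiset, Finsupp.sum_mapDomain_index (by simp)
        (by intros; simp [add_mul]), Finsupp.sum_fintype _ _ (by simp)]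
      simpa using hd.2
  · intro d e h
    apply Subtype.ext
    have h' := congrArg Subtype.val h
    have h2 := (Multiset.map_injective (f := fun i : Fin (n+1) => (i : ℕ)) Fin.val_injective h')
    simpa using congrArg Multiset.toFinsupp h2
  · rintro ⟨s, h1, h2, h3⟩
    have hs : ∃ t : Multiset (Fin (n+1)), t.map (fun i : Fin (n+1) => (i : ℕ)) = s := by
      refine ⟨s.map (fun j => Fin.ofNat (n+1) j), ?_⟩
      rw [Multiset.map_map]
      conv_rhs => rw [← Multiset.map_id s]
      apply Multiset.map_congr rfl
      intro x hx
      have := h2 x hx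
      simp [Fin.ofNat]
      omega
    obtain ⟨t, rfl⟩ := hs
    have ht : Finsupp.toMultiset (Multiset.toFinsupp t) = t := Multiset.toFinsupp_toMultiset t
    refine ⟨⟨Multiset.toFinsupp t, ?_⟩, ?_⟩
    · generalize Multiset.toFinsupp t = d at ht
      subst ht
      simp only [Set.mem_ofPred_eq]
      rw [weight_wt, Prod.ext_iff]
      simp only [Nat.cast_inj]
      rw [Multiset.card_map, Finsupp.card_toMultiset, Finsupp.sum_fintype _ _ (by simp)] at h1
      rw [Finsupp.toMultiset_map, Finsupp.sum_toMultiset, Finsupp.sum_mapDomain_index (by simp)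
        (by intros; simp [add_mul]), Finsupp.sum_fintype _ _ (by simp)] at h3
      exact ⟨by simpa using h1, by simpa using h3⟩
    · apply Subtype.ext
      simp [ht]

noncomputable def basisVV (n r m : ℕ) :
    Module.Basis {d : Fin (n+1) →₀ ℕ | Finsupp.weight (wt n) d = ((r : ℤ), (m : ℤ))} ℚ (VV n r m) :=
  (basisRestrictSupport ℚ _).map
    (LinearEquiv.ofEq _ _ (weightedHomogeneousSubmodule_eq_finsupp_supported ℚ (wt n) _).symm)

instance finVV (n r m : ℕ) : Module.Finite ℚ (VV n r m) := by
  have := (boxSet_finite r n m).to_subtype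
  have := Finite.of_equiv _ (expEquivBox n r m).symm
  exact Module.Finite.of_basis (basisVV n r m)

lemma finrank_VV (n r m : ℕ) : Module.finrank ℚ (VV n r m) = p r n m := by
  rw [Module.finrank_eq_nat_card_basis (basisVV n r m), Nat.card_congr (expEquivBox n r m),
    Nat.card_coe_set_eq, p_eq]

/-- Lowering operator. -/
noncomputable def DD (n : ℕ) :
    Derivation ℚ (MvPolynomial (Fin (n+1)) ℚ) (MvPolynomial (Fin (n+1)) ℚ) :=
  mkDerivation ℚ (fun i => C (i : ℚ) * X (i - 1))

/-- Raising operator. -/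
noncomputable def UU (n : ℕ) :
    Derivation ℚ (MvPolynomial (Fin (n+1)) ℚ) (MvPolynomial (Fin (n+1)) ℚ) :=
  mkDerivation ℚ (fun i => C ((n : ℚ) - i) * X (i + 1))

/-- Weight operator. -/
noncomputable def HH (n : ℕ) :
    Derivation ℚ (MvPolynomial (Fin (n+1)) ℚ) (MvPolynomial (Fin (n+1)) ℚ) :=
  mkDerivation ℚ (fun i => C ((n : ℚ) - 2 * i) * X i)

lemma comm_DU (n : ℕ) : ⁅DD n, UU n⁆ = HH n := by
  apply derivation_ext
  intro i
  rw [Derivation.commutator_apply]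
  have h1 : UU n (X i) = C ((n : ℚ) - i) * X (i + 1) := mkDerivation_X _ _ _
  have h2 : DD n (X i) = C (i : ℚ) * X (i - 1) := mkDerivation_X _ _ _
  have h3 : HH n (X i) = C ((n : ℚ) - 2 * i) * X i := mkDerivation_X _ _ _
  have h4 : DD n (X (i+1)) = C (((i + 1 : Fin (n+1)) : ℕ) : ℚ) * X i := by
    simp [DD]
  have h5 : UU n (X (i-1)) = C ((n : ℚ) - ((i - 1 : Fin (n+1)) : ℕ)) * X i := by
    simp [UU]
  rw [h1, h2, h3]
  simp only [C_mul', Derivation.map_smul] at h4 h5 ⊢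
  rw [h4, h5]
  simp only [smul_smul, ← sub_smul]
  congr 1
  have e1 : ((n : ℚ) - i) * (((i + 1 : Fin (n+1)) : ℕ) : ℚ) = ((n : ℚ) - i) * (i + 1) := by
    rw [Fin.val_add_one]
    split_ifs with h
    · subst h; simp
    · push_cast; ring
  have e2 : (i : ℚ) * ((n : ℚ) - ((i - 1 : Fin (n+1)) : ℕ)) = i * (n - (i - 1)) := by
    by_cases h : i = 0
    · subst h; simp
    · rw [Fin.val_sub_one_of_ne_zero h]
      have : 1 ≤ (i : ℕ) := by
        have : (i : ℕ) ≠ 0 := fun h' => h (Fin.ext h')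
        omega
      push_cast [Nat.cast_sub this]; ring
  rw [e1, e2]; ring

lemma mkDerivation_eq_sum (n : ℕ) (f : Fin (n+1) → MvPolynomial (Fin (n+1)) ℚ)
    (q : MvPolynomial (Fin (n+1)) ℚ) : mkDerivation ℚ f q = ∑ i, pderiv i q * f i := by
  induction q using MvPolynomial.induction_on with
  | C a => simp [derivation_C]
  | add a b ha hb => simp only [map_add, ha, hb, add_mul, Finset.sum_add_distrib]
  | mul_X a j ha =>
    rw [Derivation.leibniz, ha, mkDerivation_X]
    simp only [Derivation.leibniz, smul_eq_mul, add_mul, Finset.sum_add_distrib, Finset.mul_sum]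
    congr 1
    · rw [Finset.sum_eq_single j]
      · simp
      · intro i _ hi
        rw [pderiv_X_of_ne hi.symm]; simp
      · simp
    · exact Finset.sum_congr rfl fun i _ => by ring

/-- A derivation shifting the weight of each variable by `c` shifts all weights by `c`. -/
lemma derivation_weight (n : ℕ) (f : Fin (n+1) → MvPolynomial (Fin (n+1)) ℚ) (c : ℤ × ℤ)
    (hf : ∀ i, IsWeightedHomogeneous (wt n) (f i) (wt n i + c)) (v : ℤ × ℤ)
    (q : MvPolynomial (Fin (n+1)) ℚ) (hq : IsWeightedHomogeneous (wt n) q v) :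
    IsWeightedHomogeneous (wt n) (mkDerivation ℚ f q) (v + c) := by
  rw [mkDerivation_eq_sum]
  apply IsWeightedHomogeneous.sum
  intro i _
  have h1 : IsWeightedHomogeneous (wt n) (pderiv i q) (v - wt n i) := hq.pderiv (by abel)
  have := h1.mul (hf i)
  rwa [show v - wt n i + (wt n i + c) = v + c by abel] at this

lemma DD_mem (n : ℕ) {r m : ℤ} {q} (hq : q ∈ VV n r m) : DD n q ∈ VV n r (m - 1) := by
  have := derivation_weight n (fun i => C (i : ℚ) * X (i - 1)) (0, -1) ?_ (r, m) q hq
  · rw [show ((r, m) + (0, -1) : ℤ × ℤ) = (r, m - 1) by ext <;> simp [sub_eq_add_neg]] at this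
    rw [mem_weightedHomogeneousSubmodule, DD]
    exact this
  · intro i
    by_cases h : i = 0
    · subst h; simp [isWeightedHomogeneous_zero]
    · have := (isWeightedHomogeneous_X ℚ (wt n) (i - 1)).C_mul (i : ℚ)
      convert this using 1
      have h1 : 1 ≤ (i : ℕ) := by
        have : (i : ℕ) ≠ 0 := fun h' => h (Fin.ext h')
        omega
      simp [wt, Fin.val_sub_one_of_ne_zero h]
      omega

lemma UU_mem (n : ℕ) {r m : ℤ} {q} (hq : q ∈ VV n r m) : UU n q ∈ VV n r (m + 1) := by
  have := derivation_weight n (fun i => C ((n : ℚ) - i) * X (i + 1)) (0, 1) ?_ (r, m) q hq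
  · rw [show ((r, m) + (0, 1) : ℤ × ℤ) = (r, m + 1) by ext <;> simp] at this
    rw [mem_weightedHomogeneousSubmodule, UU]
    exact this
  · intro i
    by_cases h : i = Fin.last n
    · subst h; simp [isWeightedHomogeneous_zero]
    · have := (isWeightedHomogeneous_X ℚ (wt n) (i + 1)).C_mul ((n : ℚ) - i)
      convert this using 1
      simp [wt, Fin.val_add_one, h]

lemma HH_apply (n : ℕ) {r m : ℤ} {q} (hq : q ∈ VV n r m) :
    HH n q = ((n : ℚ) * r - 2 * m) • q := by
  have hq : IsWeightedHomogeneous (wt n) q (r, m) := hq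
  induction hq using IsWeightedHomogeneous.induction_on with
  | zero => simp
  | add a b ha hb iha ihb => rw [map_add, iha ha, ihb hb, smul_add]
  | monomial d c hd =>
    have hi : ∀ i : Fin (n+1), pderiv i (monomial d c) * (C ((n : ℚ) - 2 * i) * X i)
        = C ((n : ℚ) - 2 * i) * (d i • monomial d c) := by
      intro i
      rw [← X_mul_pderiv_monomial]; ring
    rw [HH, mkDerivation_eq_sum, Finset.sum_congr rfl fun i _ => hi i]
    rw [weight_wt, Prod.ext_iff] at hd
    obtain ⟨h1, h2⟩ := hd
    simp only at h1 h2
    rw [← h1, ← h2]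
    simp only [C_mul', ← Nat.cast_smul_eq_nsmul ℚ, smul_smul, ← Finset.sum_smul]
    congr 1
    push_cast
    rw [Finset.mul_sum, Finset.mul_sum, ← Finset.sum_sub_distrib]
    exact Finset.sum_congr rfl fun i _ => by ring

lemma VV_neg (n : ℕ) {r m : ℤ} (hm : m < 0) {q} (hq : q ∈ VV n r m) : q = 0 := by
  have hq : IsWeightedHomogeneous (wt n) q (r, m) := hq
  apply hq.eq_zero_of_no_monomials
  intro d hd
  rw [weight_wt, Prod.ext_iff] at hd
  have := hd.2
  simp only at this
  omega

lemma DU_eq (n : ℕ) {r m : ℤ} {q} (hq : q ∈ VV n r m) :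
    DD n (UU n q) = UU n (DD n q) + ((n : ℚ) * r - 2 * m) • q := by
  have := congrArg (fun E => E q) (comm_DU n)
  simp only [Derivation.commutator_apply] at this
  rw [HH_apply n hq] at this
  rw [← this]; abel

/-- `U D` has no negative eigenvalue in weights at most half. -/
lemma UD_eigen (n : ℕ) (r : ℤ) (k : ℕ) : ∀ (m : ℤ), m < k → 2 * m ≤ n * r → ∀ (c : ℚ), 0 < c →
    ∀ q ∈ VV n r m, UU n (DD n q) = (-c) • q → q = 0 := by
  induction k with
  | zero => intro m hm _ c _ q hq _; exact VV_neg n (by simpa using hm) hq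
  | succ k ih =>
    intro m hm hmr c hc q hq h
    have hmr' : (2 : ℚ) * m ≤ n * r := by exact_mod_cast hmr
    have hD := DD_mem n hq
    have h1 := DU_eq n hD
    rw [h, Derivation.map_smul] at h1
    have h0 : DD n q = 0 := by
      refine ih (m - 1) (by push_cast at hm; omega) (by omega)
        (c + ((n : ℚ) * r - 2 * ((m - 1 : ℤ) : ℚ))) ?_ _ hD ?_
      · push_cast; linarith
      · rw [neg_add, add_smul, h1, neg_smul]; abel
    rw [h0, map_zero] at h
    rcases smul_eq_zero.1 h.symm with h' | h'
    · linarith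
    · exact h'

/-- The lowering operator between consecutive weight spaces. -/
noncomputable def DR (n : ℕ) (r m : ℤ) : VV n r (m + 1) →ₗ[ℚ] VV n r m :=
  (DD n).toLinearMap.restrict (fun q hq => by simpa using DD_mem n hq)

lemma DR_surj (n r m : ℕ) (h : 2 * m < n * r) : Function.Surjective (DR n r m) := by
  let E : VV n r m →ₗ[ℚ] VV n r (m + 1) :=
    (UU n).toLinearMap.restrict (fun q hq => UU_mem n hq)
  have hE : Function.Injective ((DR n r m) ∘ₗ E) := by
    rw [injective_iff_map_eq_zero]
    intro q hq
    apply Subtype.ext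
    have hq' : DD n (UU n (q : MvPolynomial (Fin (n+1)) ℚ)) = 0 := congrArg Subtype.val hq
    rw [DU_eq n q.2] at hq'
    have h' : (2 : ℚ) * m < n * r := by exact_mod_cast h
    refine UD_eigen n r (m+1) m (by push_cast; omega) (by exact_mod_cast h.le)
      ((n : ℚ) * (r : ℤ) - 2 * (m : ℤ)) (by push_cast; linarith) _ q.2 ?_
    rw [neg_smul]
    exact eq_neg_of_add_eq_zero_left hq'
  have hs := LinearMap.injective_iff_surjective.1 hE
  exact Function.Surjective.of_comp hs

instance finVV' (n r m : ℕ) : Module.Finite ℚ (VV n r (m + 1)) :=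
  inferInstanceAs (Module.Finite ℚ (VV n r ((m + 1 : ℕ) : ℤ)))

lemma finrank_ker (n r m : ℕ) (h : 2 * m < n * r) :
    p r n m + Module.finrank ℚ (LinearMap.ker (DR n r m)) = p r n (m + 1) := by
  have h1 := LinearMap.finrank_range_add_finrank_ker (DR n r m)
  rw [LinearMap.range_eq_top.2 (DR_surj n r m h), finrank_top, finrank_VV] at h1
  rw [h1]
  exact finrank_VV n r (m + 1)

/-- Multiplication by a nonzero invariant. -/
lemma p_mul (n a b k l c : ℕ) (hk : 2 * (k + 1) = n * a) (hl : 2 * (l + 1) = n * b)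
    (h1 : p a n k + 1 ≤ p a n (k + 1)) (h2 : p b n l + c ≤ p b n (l + 1)) :
    p (a + b) n (k + l + 1) + c ≤ p (a + b) n (k + l + 2) := by
  have e1 := finrank_ker n a k (by omega)
  have e2 := finrank_ker n b l (by omega)
  have e3 := finrank_ker n (a + b) (k + l + 1) (by have := mul_add n a b; omega)
  have hpos : 0 < Module.finrank ℚ (LinearMap.ker (DR n a k)) := by omega
  have hnt : Nontrivial (LinearMap.ker (DR n a k)) := Module.nontrivial_of_finrank_pos hpos
  obtain ⟨⟨⟨f, hfV⟩, hf⟩, hf0⟩ := exists_ne (0 : LinearMap.ker (DR n a k))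
  have hfD : DD n f = 0 := congrArg Subtype.val (LinearMap.mem_ker.1 hf)
  have hfne : f ≠ 0 := by
    rintro rfl
    exact hf0 rfl
  let M : LinearMap.ker (DR n b l) →ₗ[ℚ] LinearMap.ker (DR n ((a + b : ℕ) : ℤ) ((k + l + 1 : ℕ) : ℤ)) :=
    { toFun := fun g => ⟨⟨f * g.1.1, by
        have := IsWeightedHomogeneous.mul hfV g.1.2
        have e : (((a : ℤ), (k : ℤ) + 1) + ((b : ℤ), (l : ℤ) + 1) : ℤ × ℤ)
            = (((a + b : ℕ) : ℤ), ((k + l + 1 : ℕ) : ℤ) + 1) := by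
          ext <;> simp
          ring
        rw [e] at this
        exact this⟩, by
        rw [LinearMap.mem_ker]
        apply Subtype.ext
        have hg : DD n g.1.1 = 0 := congrArg Subtype.val (LinearMap.mem_ker.1 g.2)
        change DD n (f * g.1.1) = 0
        rw [Derivation.leibniz, hfD, hg]; simp⟩
      map_add' := fun x y => by
        apply Subtype.ext; apply Subtype.ext
        simp [mul_add]
      map_smul' := fun x y => by
        apply Subtype.ext; apply Subtype.ext
        simp }
  have hM : Function.Injective M := by
    intro x y h
    have : f * x.1.1 = f * y.1.1 := congrArg (fun z => z.1.1) h
    exact Subtype.ext (Subtype.ext (mul_left_cancel₀ hfne this))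
  have := finVV' n (a + b) (k + l + 1)
  have := LinearMap.finrank_le_finrank_of_injective hM
  have e4 : k + l + 1 + 1 = k + l + 2 := rfl
  rw [e4] at e3
  omega

end SemiInvariants

/-- At least `c` invariants. -/
def HasInv (n r c : ℕ) : Prop :=
  2 ≤ n * r ∧ Even (n * r) ∧ p r n (n * r / 2 - 1) + c ≤ p r n (n * r / 2)

lemma HasInv.of {n r c g h : ℕ} (h3 : p r n g + c ≤ p r n h) (h1 : g + 1 = h)
    (h2 : n * r = 2 * h) : HasInv n r c := by
  refine ⟨by omega, ⟨h, by omega⟩, ?_⟩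
  rw [show n * r / 2 = h by omega, show h - 1 = g by omega]
  exact h3

lemma HasInv.symm {n r c : ℕ} (h : HasInv n r c) : HasInv r n c := by
  unfold HasInv at *
  rw [mul_comm r n, p_symm n r, p_symm n r]
  exact h

lemma HasInv.mul {n a b c : ℕ} (h1 : HasInv n a 1) (h2 : HasInv n b c) : HasInv n (a + b) c := by
  obtain ⟨ha, ⟨k, hk⟩, h1⟩ := h1
  obtain ⟨hb, ⟨l, hl⟩, h2⟩ := h2
  obtain ⟨k, rfl⟩ : ∃ k', k = k' + 1 := ⟨k - 1, by omega⟩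
  obtain ⟨l, rfl⟩ : ∃ l', l = l' + 1 := ⟨l - 1, by omega⟩
  rw [show n * a / 2 = k + 1 by omega] at h1
  rw [show n * b / 2 = l + 1 by omega] at h2
  have hab : n * (a + b) = 2 * (k + l + 2) := by rw [mul_add]; omega
  refine ⟨by omega, ⟨k + l + 2, by omega⟩, ?_⟩
  rw [show n * (a + b) / 2 = k + l + 2 by omega]
  exact p_mul n a b k l c (by omega) (by omega) h1 h2

lemma HasInv.add_mul {n a c : ℕ} (h1 : HasInv n a 1) {b : ℕ} (h2 : HasInv n b c) (j : ℕ) :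
    HasInv n (b + j * a) c := by
  induction j with
  | zero => simpa using h2
  | succ j ih =>
    rw [show b + (j + 1) * a = a + (b + j * a) by ring]
    exact h1.mul ih

lemma inv_two {r : ℕ} (h2 : 2 ≤ r) (hr : Even r) : HasInv r 2 1 := by
  have h : HasInv 2 2 1 := HasInv.of p_base6 (by norm_num) (by norm_num)
  obtain ⟨k, hk⟩ := hr
  obtain ⟨j, rfl⟩ : ∃ j, r = 2 + j * 2 := ⟨k - 1, by omega⟩
  exact (h.add_mul h j).symm

lemma inv_four {r : ℕ} (h2 : 2 ≤ r) : HasInv r 4 1 := by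
  have h : HasInv 4 2 1 := HasInv.of p_base4 (by norm_num) (by norm_num)
  have h' : HasInv 4 3 1 := HasInv.of p_base5 (by norm_num) (by norm_num)
  rcases Nat.even_or_odd r with ⟨k, hk⟩ | ⟨k, hk⟩
  · obtain ⟨j, rfl⟩ : ∃ j, r = 2 + j * 2 := ⟨k - 1, by omega⟩
    exact (h.add_mul h j).symm
  · obtain ⟨j, rfl⟩ : ∃ j, r = 3 + j * 2 := ⟨k - 1, by omega⟩
    exact (h.add_mul h' j).symm

lemma inv_even {n r : ℕ} (hn : 8 ≤ n) (hr : 8 ≤ r) (he : Even n) : HasInv n r 2 := by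
  have b1 : HasInv 8 8 2 :=
    (inv_four (by norm_num)).mul (HasInv.symm (HasInv.of p_base1 (by norm_num) (by norm_num)) : HasInv 8 4 2)
  have b2 : HasInv 9 8 2 :=
    (inv_four (by norm_num)).mul (HasInv.symm (HasInv.of p_base2 (by norm_num) (by norm_num)) : HasInv 9 4 2)
  have b3 : HasInv 9 10 2 := HasInv.symm (HasInv.of p_base3 (by norm_num) (by norm_num))
  have h8 : HasInv n 8 2 := by
    obtain ⟨k, hk⟩ := he
    obtain ⟨j, rfl⟩ : ∃ j, n = 8 + j * 2 := ⟨k - 4, by omega⟩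
    exact (HasInv.add_mul (inv_two (by norm_num) (by decide)) b1 j).symm
  have h9 : HasInv n 9 2 := by
    have h4 : HasInv 9 4 1 := inv_four (by norm_num)
    obtain ⟨k, hk⟩ := he
    rcases Nat.even_or_odd k with ⟨l, hl⟩ | ⟨l, hl⟩
    · obtain ⟨j, rfl⟩ : ∃ j, n = 8 + j * 4 := ⟨l - 2, by omega⟩
      exact (h4.add_mul b2 j).symm
    · obtain ⟨j, rfl⟩ : ∃ j, n = 10 + j * 4 := ⟨l - 2, by omega⟩
      exact (h4.add_mul b3 j).symm
  have h2 : HasInv n 2 1 := inv_two (by omega) he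
  rcases Nat.even_or_odd r with ⟨l, hl⟩ | ⟨l, hl⟩
  · obtain ⟨j, rfl⟩ : ∃ j, r = 8 + j * 2 := ⟨l - 4, by omega⟩
    exact h2.add_mul h8 j
  · obtain ⟨j, rfl⟩ : ∃ j, r = 9 + j * 2 := ⟨l - 4, by omega⟩
    exact h2.add_mul h9 j

/-- For $n, r ≥ 8$ with at least one of $n,r$ even, there are at least two
linearly independent semi-invariants of a binary $n$-form of degree $r$ and
weight $nr/2$: $p(r,n,nr/2) - p(r,n,nr/2-1) ≥ 2$. -/
theorem two_semiinvariants (n r : ℕ) (hn : 8 ≤ n) (hr : 8 ≤ r)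
    (hpar : Even n ∨ Even r) :
    p r n (n * r / 2 - 1) + 2 ≤ p r n (n * r / 2) := by
  rcases hpar with h | h
  · exact (inv_even hn hr h).2.2
  · exact (inv_even hr hn h).symm.2.2
end

section
/- A polynomial I(a_0,…,a_n), homogeneous of degree k and weight m, is invariant under every shear substitution a_i ↦ Σ_{j=0}^i C(i,j) a_{i−j} h^j (for all h ∈ ℚ) if and only if D(I) = 0, where D = Σ_{i=1}^n i a_{i−1} ∂/∂a_i. -/
open MvPolynomial

/-- Cayley's operator `D = Σ_{i=1}^n i a_{i-1} ∂/∂a_i`. -/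
noncomputable def D (n : ℕ) (f : MvPolynomial (Fin (n + 1)) ℚ) :
    MvPolynomial (Fin (n + 1)) ℚ :=
  ∑ i : Fin (n + 1), (i.val : ℚ) •
    (X (⟨i.val - 1, lt_of_le_of_lt (Nat.sub_le _ _) i.isLt⟩ : Fin (n + 1)) *
      pderiv i f)

/-- The shear substitution `a_i ↦ Σ_{j=0}^i C(i,j) a_{i-j} h^j` induced by
`x = x' + h y'`, `y = y'` on the coefficients of a binary `n`-form. -/
noncomputable def shear (n : ℕ) (h : ℚ) (f : MvPolynomial (Fin (n + 1)) ℚ) :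
    MvPolynomial (Fin (n + 1)) ℚ :=
  bind₁ (fun i : Fin (n + 1) =>
    ∑ j ∈ Finset.range (i.val + 1),
      C ((i.val.choose j : ℚ) * h ^ j) *
        X (⟨i.val - j, lt_of_le_of_lt (Nat.sub_le _ _) i.isLt⟩ : Fin (n + 1))) f

/-- Generic shear: the substitution with an indeterminate parameter. -/
noncomputable def shearGen (n : ℕ) :
    MvPolynomial (Fin (n + 1)) ℚ →ₐ[ℚ] Polynomial (MvPolynomial (Fin (n + 1)) ℚ) :=
  aeval (fun i : Fin (n + 1) =>
    ∑ j ∈ Finset.range (i.val + 1),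
      Polynomial.C (C (i.val.choose j : ℚ) *
        X (⟨i.val - j, lt_of_le_of_lt (Nat.sub_le _ _) i.isLt⟩ : Fin (n + 1))) *
        Polynomial.X ^ j)

theorem eval_shearGen (n : ℕ) (h : ℚ) (f : MvPolynomial (Fin (n + 1)) ℚ) :
    (shearGen n f).eval (C h) = shear n h f := by
  unfold shear
  induction f using MvPolynomial.induction_on with
  | C a =>
    have : shearGen n (C a) = Polynomial.C (C a) := by
      simp only [shearGen, aeval_C]; rfl
    rw [this]; simp
  | add p q hp hq => simp [hp, hq]
  | mul_X p i hp =>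
    rw [map_mul, map_mul, Polynomial.eval_mul, hp, bind₁_X_right]
    congr 1
    simp only [shearGen, aeval_X, Polynomial.eval_finsetSum, Polynomial.eval_mul,
      Polynomial.eval_C, Polynomial.eval_pow, Polynomial.eval_X, C_mul, C_pow]
    refine Finset.sum_congr rfl fun j _ => ?_
    ring

theorem shear_zero (n : ℕ) (f : MvPolynomial (Fin (n + 1)) ℚ) : shear n 0 f = f := by
  unfold shear
  conv_rhs => rw [← AlgHom.id_apply (R := ℚ) f, ← bind₁_X_left]
  congr 2
  funext i
  rw [Finset.sum_range_succ']
  simp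

theorem D_X (n : ℕ) (i : Fin (n + 1)) : D n (X i) = (i.val : ℚ) •
    X (⟨i.val - 1, lt_of_le_of_lt (Nat.sub_le _ _) i.isLt⟩ : Fin (n + 1)) := by
  unfold D
  rw [Finset.sum_eq_single i]
  · simp
  · intro j _ hj
    rw [pderiv_X_of_ne hj.symm]; simp
  · simp

theorem D_mul (n : ℕ) (p q : MvPolynomial (Fin (n + 1)) ℚ) :
    D n (p * q) = D n p * q + p * D n q := by
  unfold D
  rw [Finset.sum_mul, Finset.mul_sum, ← Finset.sum_add_distrib]
  refine Finset.sum_congr rfl fun j _ => ?_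
  rw [pderiv_mul]
  simp only [smul_eq_C_mul]
  ring

theorem derivative_shearGen_X (n : ℕ) (i : Fin (n + 1)) :
    Polynomial.derivative (shearGen n (X i)) = shearGen n (D n (X i)) := by
  rw [D_X, map_smul]
  obtain ⟨i, hi⟩ := i
  cases i with
  | zero => simp [shearGen]
  | succ i =>
    simp only [shearGen, aeval_X, Polynomial.derivative_sum]
    rw [Finset.sum_range_succ']
    simp only [Nat.add_sub_cancel, Finset.smul_sum]
    have h0 : ∀ p : MvPolynomial (Fin (n + 1)) ℚ,
        Polynomial.derivative (Polynomial.C p * Polynomial.X ^ 0) = 0 := by simp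
    rw [h0, add_zero]
    refine Finset.sum_congr rfl fun j _ => ?_
    rw [Polynomial.derivative_C_mul_X_pow, Nat.add_sub_cancel, ← smul_mul_assoc,
      Polynomial.smul_C]
    congr 2
    have e : (⟨i + 1 - (j + 1), lt_of_le_of_lt (Nat.sub_le _ _) hi⟩ : Fin (n + 1)) =
        ⟨i - j, by omega⟩ := by
      ext; simp
    have hc : (((i + 1).choose (j + 1) : ℕ) : ℚ) * ((j + 1 : ℕ) : ℚ) =
        ((i + 1 : ℕ) : ℚ) * (i.choose j : ℚ) := by
      exact_mod_cast (Nat.add_one_mul_choose_eq i j).symm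
    have hn : ((j + 1 : ℕ) : MvPolynomial (Fin (n + 1)) ℚ) = C ((j + 1 : ℕ) : ℚ) := by
      simp
    rw [e, hn, smul_eq_C_mul, ← mul_assoc, ← C_mul, ← hc, C_mul]
    ring

theorem derivative_shearGen (n : ℕ) (f : MvPolynomial (Fin (n + 1)) ℚ) :
    Polynomial.derivative (shearGen n f) = shearGen n (D n f) := by
  induction f using MvPolynomial.induction_on with
  | C a =>
    have : shearGen n (C a) = Polynomial.C (C a) := by
      simp only [shearGen, aeval_C]; rfl
    rw [this]; simp [D]
  | add p q hp hq =>
    have : D n (p + q) = D n p + D n q := by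
      simp [D, mul_add, Finset.sum_add_distrib]
    simp [hp, hq, this]
  | mul_X p i hp =>
    rw [D_mul, map_mul, Polynomial.derivative_mul, hp, map_add, map_mul, map_mul]
    rw [derivative_shearGen_X]

/-- A polynomial in `a_0, …, a_n`, homogeneous of degree `k` and isobaric of
weight `m`, is invariant under every shear substitution iff it is annihilated
by Cayley's operator `D`. -/
theorem shear_invariant_iff_D_eq_zero (n k m : ℕ)
    (I : MvPolynomial (Fin (n + 1)) ℚ) (hdeg : I.IsHomogeneous k)
    (hw : I.IsWeightedHomogeneous (fun i : Fin (n + 1) => (i.val : ℕ)) m) :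
    (∀ h : ℚ, shear n h I = I) ↔ D n I = 0 := by
  constructor
  · intro H
    have h1 : shearGen n I = Polynomial.C I := by
      apply Polynomial.eq_of_infinite_eval_eq
      refine (Set.infinite_range_of_injective (C_injective (Fin (n + 1)) ℚ)).mono ?_
      rintro _ ⟨h, rfl⟩
      simp only [Set.mem_ofPred_eq, Polynomial.eval_C]
      rw [eval_shearGen, H]
    have h2 := derivative_shearGen n I
    rw [h1, Polynomial.derivative_C] at h2
    rw [← shear_zero n (D n I), ← eval_shearGen, ← h2, Polynomial.eval_zero]
  · intro H h
    have h2 := derivative_shearGen n I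
    rw [H, map_zero] at h2
    have h3 := Polynomial.eq_C_of_derivative_eq_zero h2
    have h4 := eval_shearGen n h I
    have h5 := eval_shearGen n 0 I
    rw [shear_zero] at h5
    rw [h3, Polynomial.eval_C] at h4 h5
    rw [← h4, h5]
end
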